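/- arXiv:2012.12460 — 2 statements merged into one kernel-verified Lean document; each statement's English description precedes it below -/
import Mathlib

section
/- Let n > 4 and let h ∈ S_n be an (n−1)-cycle. (1) If n is even, then the maximum of χ(h)/χ(1) over all irreducible complex characters χ of S_n with χ(1) ≠ 1 equals 3/(n(n−2)(n−4)); consequently the corresponding eigenvalue of H⁺, where H is the conjugacy class of h, equals 3(n−3)·(n−5)!. (2) If n is odd, then this maximum equals 2/(n(n−3)), and the corresponding eigenvalue of H⁺ equals 2(n−2)·(n−4)!. -/
open Equiv

open Polynomial in
/-- The polynomial `det (1 + X g)` of a permutation `g`. Its coefficients are the characters of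
the exterior powers of the permutation representation. -/
noncomputable def permPoly {α : Type*} [Fintype α] [DecidableEq α] (g : Perm α) : ℝ[X] :=
  (1 + (X : ℝ[X]) • (g.permMatrix ℝ).map C).det

/-- The determinant of the submatrix of a permutation matrix with rows and columns in `A`: the sign
of `g` on `A` if `g` preserves `A`, and `0` otherwise. -/
noncomputable def permMinor {α : Type*} [Fintype α] [DecidableEq α] (g : Perm α) (A : Finset α) :
    ℝ :=
  ((g.permMatrix ℝ).submatrix (Subtype.val : A → α) (Subtype.val : A → α)).det

theorem permMatrix_permCongr {α β : Type*} [DecidableEq α] [DecidableEq β] (e : α ≃ β)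
    (g : Perm α) :
    (e.permCongr g).permMatrix ℝ = (g.permMatrix ℝ).submatrix e.symm e.symm := by
  ext i j
  simp [PEquiv.toMatrix_apply, Equiv.eq_symm_apply]

section PermPoly

open Polynomial

variable {α β : Type*} [Fintype α] [DecidableEq α] [Fintype β] [DecidableEq β]

theorem permPoly_coeff (g : Perm α) (k : ℕ) :
    (permPoly g).coeff k = ∑ A ∈ Finset.univ.powersetCard k, permMinor g A :=
  Matrix.coeff_det_one_add_X_smul_eq_sum_minors _ _

theorem permPoly_permCongr (e : α ≃ β) (g : Perm α) :
    permPoly (e.permCongr g) = permPoly g := by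
  rw [permPoly, permMatrix_permCongr, permPoly, ← Matrix.det_submatrix_equiv_self e.symm]
  congr 1
  ext1 i j
  simp [Matrix.one_apply]

theorem permPoly_conj (p g : Perm α) : permPoly (p * g * p⁻¹) = permPoly g :=
  permPoly_permCongr p g

theorem permPoly_sumCongr (σ : Perm α) (τ : Perm β) :
    permPoly (Equiv.sumCongr σ τ) = permPoly σ * permPoly τ := by
  rw [permPoly, permPoly, permPoly, ← Matrix.det_fromBlocks_zero₁₂ _ 0 _]
  congr 1
  ext1 (i | i) (j | j) <;> simp [PEquiv.toMatrix_apply, Matrix.one_apply]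

theorem permPoly_subtypeCongr {p : α → Prop} [DecidablePred p] (σ : Perm {x // p x})
    (τ : Perm {x // ¬ p x}) :
    permPoly (Perm.subtypeCongr σ τ) = permPoly σ * permPoly τ := by
  rw [Perm.subtypeCongr, permPoly_permCongr]
  exact permPoly_sumCongr σ τ

theorem permPoly_one : permPoly (1 : Perm α) = (1 + X) ^ Fintype.card α := by
  have : (1 + (X : ℝ[X]) • ((1 : Perm α).permMatrix ℝ).map C) =
      (1 + X : ℝ[X]) • (1 : Matrix α α ℝ[X]) := by
    rw [Matrix.permMatrix_one]
    simp [add_smul]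
  rw [permPoly, this, Matrix.det_smul, Matrix.det_one, mul_one]

theorem permPoly_optionCongr (g : Perm α) :
    permPoly (Equiv.optionCongr g) = (1 + X) * permPoly g := by
  have h : Equiv.optionCongr g = (Equiv.optionEquivSumPUnit α).symm.permCongr
      (Equiv.sumCongr g (1 : Perm PUnit.{1})) := by
    ext1 (_ | x) <;> simp [Equiv.permCongr_apply]
  rw [h, permPoly_permCongr, permPoly_sumCongr, permPoly_one]
  simp [mul_comm]

theorem permMinor_conj (p g : Perm α) (A : Finset α) :
    permMinor (p * g * p⁻¹) (A.map p.toEmbedding) = permMinor g A := by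
  have h := permMatrix_permCongr p g
  rw [show p.permCongr g = p * g * p⁻¹ from rfl] at h
  rw [permMinor, permMinor, h, ← Matrix.det_submatrix_equiv_self
    (p.subtypeEquiv fun a => (Finset.mem_map' p.toEmbedding).symm :
      {x // x ∈ A} ≃ {x // x ∈ A.map p.toEmbedding})]
  congr 1
  ext1 i j
  change g.permMatrix ℝ (p.symm (p i)) (p.symm (p j)) = _
  rw [Equiv.symm_apply_apply, Equiv.symm_apply_apply]
  rfl

theorem permMinor_eq_zero {g : Perm α} {A : Finset α} {a : α} (ha : a ∈ A) (hg : g a ∉ A) :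
    permMinor g A = 0 := by
  refine Matrix.det_eq_zero_of_row_eq_zero ⟨a, ha⟩ fun j => ?_
  have : g a ≠ j := fun h => hg (h ▸ j.2)
  simp [PEquiv.toMatrix_apply, this]

theorem permMinor_subtypeCongr (A : Finset α) (σ : Perm {x // x ∈ A}) (τ : Perm {x // x ∉ A}) :
    permMinor (Perm.subtypeCongr σ τ) A = (Perm.sign σ : ℤ) := by
  rw [permMinor, ← Matrix.det_permutation σ]
  congr 1
  ext1 i j
  have h : Perm.subtypeCongr σ τ i = σ i := Perm.subtypeCongr.left_apply _ _ i.2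
  simp only [Matrix.submatrix_apply, Equiv.Perm.permMatrix, PEquiv.toMatrix_apply,
    Equiv.toPEquiv_apply, h, Option.mem_some_iff, Subtype.ext_iff]

theorem sum_permMinor_smul {M : Type*} [AddCommGroup M] [Module ℝ M] (A : Finset α)
    (φ : Perm α → M) :
    ∑ g, permMinor g A • φ g = ∑ σ : Perm {x // x ∈ A}, ∑ τ : Perm {x // x ∉ A},
      ((Perm.sign σ : ℤ) : ℝ) • φ (Perm.subtypeCongr σ τ) := by
  rw [← Fintype.sum_prod_type']
  symm
  refine Finset.sum_bij_ne_zero (fun x _ _ => Perm.subtypeCongr x.1 x.2) (by simp) ?_ ?_ ?_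
  · intro x _ _ y _ _ h
    exact Perm.subtypeCongrHom_injective (· ∈ A) h
  · intro g _ hg
    have hA : ∀ a ∈ A, g a ∈ A := fun a ha => by
      by_contra h
      exact hg (by rw [permMinor_eq_zero ha h, zero_smul])
    have hA' : ∀ a, g a ∈ A ↔ a ∈ A := fun a =>
      ⟨fun h => by
        have := Finset.eq_of_subset_of_card_le
          (Finset.image_subset_iff.2 hA : A.image g ⊆ A)
          (by rw [Finset.card_image_of_injective _ g.injective])
        rw [← this, Finset.mem_image] at h
        obtain ⟨b, hb, hab⟩ := h
        rwa [← g.injective hab], hA a⟩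
    have key : Perm.subtypeCongr (g.subtypePerm hA') (g.subtypePerm fun a => not_congr (hA' a))
        = g := by
      ext a
      by_cases h : a ∈ A
      · rw [Perm.subtypeCongr.left_apply _ _ h]; rfl
      · rw [Perm.subtypeCongr.right_apply _ _ h]; rfl
    refine ⟨(g.subtypePerm hA', g.subtypePerm fun a => not_congr (hA' a)), by simp, ?_, key⟩
    rw [← permMinor_subtypeCongr A _ (g.subtypePerm fun a => not_congr (hA' a)), key]
    exact hg
  · intro x _ _
    rw [permMinor_subtypeCongr]

theorem sum_sign (α : Type*) [Fintype α] [DecidableEq α] :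
    ∑ g : Perm α, ((Perm.sign g : ℤ) : ℝ) = if Fintype.card α ≤ 1 then 1 else 0 := by
  split_ifs with h
  · have := Fintype.card_le_one_iff_subsingleton.1 h
    rw [Fintype.sum_subsingleton _ 1]; simp
  · obtain ⟨a, b, hab⟩ := Fintype.one_lt_card_iff.1 (not_le.1 h)
    have := Fintype.sum_equiv (Equiv.mulRight (swap a b))
      (fun g => ((Perm.sign (g * swap a b) : ℤ) : ℝ)) (fun g => ((Perm.sign g : ℤ) : ℝ))
      (fun g => rfl)
    simp only [Perm.sign_mul, Perm.sign_swap hab] at this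
    simp at this
    linarith

theorem sum_permPoly (α : Type*) [Fintype α] [DecidableEq α] :
    ∑ g : Perm α, permPoly g =
      (((Fintype.card α).factorial : ℕ) : ℝ) • if Fintype.card α = 0 then 1 else 1 + X := by
  ext k
  have h1 (A : Finset α) := sum_permMinor_smul A (fun _ => (1 : ℝ))
  simp only [smul_eq_mul, mul_one, Finset.sum_const, Finset.card_univ, ← Finset.smul_sum,
    sum_sign, Fintype.card_perm, Fintype.card_subtype_compl, Fintype.card_coe] at h1
  rw [finsetSum_coeff]
  simp_rw [permPoly_coeff]
  rw [Finset.sum_comm]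
  simp_rw [h1]
  rw [Finset.sum_congr rfl (g := fun _ => (Fintype.card α - k).factorial •
    (if k ≤ 1 then (1 : ℝ) else 0)) fun A hA => by rw [(Finset.mem_powersetCard.1 hA).2]]
  rw [Finset.sum_const, Finset.card_powersetCard, Finset.card_univ]
  rcases hα : Fintype.card α with _ | n
  · rcases k with _ | k <;> simp [coeff_one]
  · rcases k with _ | _ | k
    · simp
    · simp [coeff_one, Nat.factorial_succ]
    · simp [coeff_one, coeff_X]

theorem sum_sign_smul_permPoly (α : Type*) [Fintype α] [DecidableEq α] :
    ∑ g : Perm α, ((Perm.sign g : ℤ) : ℝ) • permPoly g =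
      (((Fintype.card α).factorial : ℕ) : ℝ) •
        if Fintype.card α = 0 then 1 else X ^ (Fintype.card α - 1) * (1 + X) := by
  ext k
  have h1 (A : Finset α) : ∑ g, permMinor g A * ((Perm.sign g : ℤ) : ℝ) =
      A.card.factorial • (if Fintype.card α - A.card ≤ 1 then (1 : ℝ) else 0) := by
    have hs (σ : Perm {x // x ∈ A}) (τ : Perm {x // x ∉ A}) : ((Perm.sign σ : ℤ) : ℝ) *
        ((Perm.sign (Perm.subtypeCongr σ τ) : ℤ) : ℝ) = ((Perm.sign τ : ℤ) : ℝ) := by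
      have : Perm.sign (Perm.subtypeCongr σ τ) = Perm.sign σ * Perm.sign τ := by
        convert Perm.sign_subtypeCongr σ τ
      rw [this, ← Int.cast_mul, ← Units.val_mul, ← mul_assoc, Int.units_mul_self, one_mul]
    have := sum_permMinor_smul A (fun g => ((Perm.sign g : ℤ) : ℝ))
    simp only [smul_eq_mul, hs, sum_sign, Finset.sum_const, Finset.card_univ, Fintype.card_perm,
      Fintype.card_subtype_compl, Fintype.card_coe] at this
    exact this
  rw [finsetSum_coeff]
  simp_rw [coeff_smul, permPoly_coeff, smul_eq_mul, Finset.mul_sum]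
  rw [Finset.sum_comm]
  simp_rw [mul_comm _ (permMinor _ _), h1]
  rw [Finset.sum_congr rfl (g := fun _ => k.factorial •
    (if Fintype.card α - k ≤ 1 then (1 : ℝ) else 0)) fun A hA => by
      rw [(Finset.mem_powersetCard.1 hA).2]]
  rw [Finset.sum_const, Finset.card_powersetCard, Finset.card_univ]
  rcases hα : Fintype.card α with _ | n
  · rcases k with _ | k <;> simp [coeff_one]
  · rcases Nat.lt_or_ge (n + 1) k with h | h
    · rw [Nat.choose_eq_zero_of_lt h]
      have h1 : k ≠ n := by omega
      simp [mul_add, coeff_X_pow, ← pow_succ, h1, h.ne']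
    · obtain ⟨j, hj⟩ := Nat.exists_eq_add_of_le h
      rcases j with _ | _ | j
      · obtain rfl : k = n + 1 := by omega
        simp [mul_add, coeff_X_pow, ← pow_succ]
      · obtain rfl : k = n := by omega
        simp [mul_add, coeff_X_pow, ← pow_succ, Nat.factorial_succ]
      · have h1 : k ≠ n := by omega
        have h2 : k ≠ n + 1 := by omega
        have h3 : ¬ n < 1 + k := by omega
        simp [mul_add, coeff_X_pow, ← pow_succ, h1, h2, h3]

/-- The generating polynomial of the inner products of a fixed exterior power with all the exterior
powers of the permutation representation. -/
theorem sum_coeff_smul_permPoly (α : Type*) [Fintype α] [DecidableEq α] (k : ℕ) :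
    ∑ g : Perm α, (permPoly g).coeff k • permPoly g =
      if k ≤ Fintype.card α then (((Fintype.card α).factorial : ℕ) : ℝ) •
        ((if k = 0 then 1 else X ^ (k - 1) * (1 + X)) *
          if Fintype.card α - k = 0 then 1 else 1 + X) else 0 := by
  simp_rw [permPoly_coeff, Finset.sum_smul]
  rw [Finset.sum_comm]
  have h1 (A : Finset α) : ∑ g : Perm α, permMinor g A • permPoly g =
      ((A.card.factorial : ℕ) : ℝ) •
        (if A.card = 0 then 1 else X ^ (A.card - 1) * (1 + X)) *
      (((Fintype.card α - A.card).factorial : ℕ) : ℝ) •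
        if Fintype.card α - A.card = 0 then 1 else 1 + X := by
    have h2 (σ : Perm {x // x ∈ A}) (τ : Perm {x // x ∉ A}) :
        permPoly (Perm.subtypeCongr σ τ) = permPoly σ * permPoly τ := by
      convert permPoly_subtypeCongr σ τ
    rw [sum_permMinor_smul]
    simp only [h2, ← smul_mul_assoc, ← Finset.sum_mul_sum, sum_permPoly, sum_sign_smul_permPoly,
      Fintype.card_subtype_compl, Fintype.card_coe]
  simp only [h1]
  by_cases h : k ≤ Fintype.card α
  · rw [if_pos h, Finset.sum_congr rfl (g := fun _ => ((k.factorial : ℕ) : ℝ) •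
      (if k = 0 then 1 else X ^ (k - 1) * (1 + X)) *
      (((Fintype.card α - k).factorial : ℕ) : ℝ) • if Fintype.card α - k = 0 then 1 else 1 + X)
      fun A hA => by rw [(Finset.mem_powersetCard.1 hA).2]]
    rw [Finset.sum_const, Finset.card_powersetCard, Finset.card_univ,
      ← Nat.choose_mul_factorial_mul_factorial h]
    rw [smul_mul_smul_comm, ← Nat.cast_smul_eq_nsmul ℝ, smul_smul]
    push_cast
    rw [mul_assoc]
  · rw [if_neg h, Finset.powersetCard_eq_empty.2 (by simpa using h), Finset.sum_empty]

end PermPoly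

/-- The alternating partial sums `f k - f (k - 1) + ⋯ ± f 0` of a sequence. -/
def altSum (f : ℕ → ℝ) : ℕ → ℝ
  | 0 => f 0
  | k + 1 => f (k + 1) - altSum f k

theorem altSum_coeff (q : Polynomial ℝ) : altSum ((1 + Polynomial.X) * q).coeff = q.coeff := by
  ext k
  induction k with
  | zero => simp [altSum]
  | succ k ih => rw [altSum, ih]; simp [add_mul]

theorem sum_mul_altSum {ι : Type*} (s : Finset ι) (c : ι → ℝ) (f : ι → ℕ → ℝ) (k : ℕ) :
    ∑ i ∈ s, c i * altSum (f i) k = altSum (fun j => ∑ i ∈ s, c i * f i j) k := by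
  induction k with
  | zero => rfl
  | succ k ih => simp only [altSum, mul_sub, Finset.sum_sub_distrib, ih]

/-- The number of fixed points of a permutation. -/
def fixCount {α : Type*} [Fintype α] [DecidableEq α] (g : Perm α) : ℝ :=
  ∑ a, if g a = a then 1 else 0

/-- The embedding of the symmetric group on `m` points as a point stabiliser in the symmetric group
on `m + 1` points. -/
def stabHom (m : ℕ) : Perm (Fin m) →* Perm (Fin (m + 1)) where
  toFun g := (finSuccEquiv m).symm.permCongr (optionCongr g)
  map_one' := by ext1 x; simp [Equiv.permCongr_apply]
  map_mul' g g' := by ext1 x; simp [Equiv.permCongr_apply, Option.map_map]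

theorem stabHom_eq_decomposeFin {m : ℕ} (g : Perm (Fin m)) :
    stabHom m g = Perm.decomposeFin.symm (0, g) := by
  ext1 x
  refine Fin.cases ?_ (fun i => ?_) x
  · simp [stabHom]
  · simp [stabHom]

theorem fixCount_stabHom {m : ℕ} (g : Perm (Fin m)) :
    fixCount (stabHom m g) = fixCount g + 1 := by
  rw [fixCount, Fin.sum_univ_succ, fixCount, stabHom_eq_decomposeFin, add_comm]
  simp

theorem permPoly_stabHom {m : ℕ} (g : Perm (Fin m)) :
    permPoly (stabHom m g) = (1 + Polynomial.X) * permPoly g := by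
  rw [← permPoly_optionCongr]
  exact permPoly_permCongr _ _

theorem sum_fixCount_smul {M : Type*} [AddCommGroup M] [Module ℝ M] {m : ℕ}
    {F : Perm (Fin (m + 1)) → M} (hF : ∀ p g, F (p * g * p⁻¹) = F g) :
    ∑ g, fixCount g • F g = ((m + 1 : ℕ) : ℝ) • ∑ g, F (stabHom m g) := by
  have h0 : ∑ g : Perm (Fin (m + 1)), (if g 0 = 0 then F g else 0) = ∑ g, F (stabHom m g) := by
    rw [← Perm.decomposeFin.symm.sum_comp, Fintype.sum_prod_type, Fin.sum_univ_succ]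
    simp [stabHom_eq_decomposeFin]
  have h1 (a : Fin (m + 1)) : ∑ g : Perm (Fin (m + 1)), (if g a = a then F g else 0) =
      ∑ g, F (stabHom m g) := by
    rw [← h0]
    refine Fintype.sum_equiv (MulAut.conj (swap 0 a)).toEquiv _ _ fun g => ?_
    have : (swap 0 a * g * (swap 0 a)⁻¹) 0 = 0 ↔ g a = a := by
      simp [Perm.mul_apply, Equiv.swap_apply_eq_iff]
    simp only [MulEquiv.toEquiv_eq_coe, MulEquiv.coe_toEquiv, MulAut.conj_apply, hF, this]
  simp only [fixCount, Finset.sum_smul]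
  rw [Finset.sum_comm]
  simp only [ite_smul, one_smul, zero_smul, h1, Finset.sum_const, Finset.card_univ,
    Fintype.card_fin, Nat.cast_smul_eq_nsmul]

section

open Polynomial

variable {α : Type*} [Fintype α] [DecidableEq α]

/-- The alternating sum of the exterior powers up to degree `k` of the permutation character: the
character of the `k`-th exterior power of the standard representation. -/
noncomputable def hookChar (k : ℕ) (g : Perm α) : ℝ := altSum (permPoly g).coeff k

/-- The iterated alternating sum of the exterior powers of the permutation character, which
extends the `k`-th exterior power of the standard representation of a point stabiliser. -/
noncomputable def subhookChar (k : ℕ) (g : Perm α) : ℝ := altSum (fun j => hookChar j g) k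

/-- The class function which is the irreducible character attached to the partition
`(n - k - 1, 2, 1 ^ (k - 1))` when `1 ≤ k ≤ n - 3`. -/
noncomputable def nearHookChar (k : ℕ) (g : Perm α) : ℝ :=
  fixCount g * subhookChar k g - (permPoly g).coeff (k + 1)

theorem hookChar_stabHom {m : ℕ} (k : ℕ) (g : Perm (Fin m)) :
    hookChar k (stabHom m g) = (permPoly g).coeff k := by
  rw [hookChar, permPoly_stabHom, altSum_coeff]

theorem subhookChar_stabHom {m : ℕ} (k : ℕ) (g : Perm (Fin m)) :
    subhookChar k (stabHom m g) = hookChar k g := by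
  simp only [subhookChar, hookChar_stabHom]
  rfl

theorem hookChar_conj (k : ℕ) (p g : Perm α) : hookChar k (p * g * p⁻¹) = hookChar k g := by
  rw [hookChar, permPoly_conj, hookChar]

theorem subhookChar_conj (k : ℕ) (p g : Perm α) :
    subhookChar k (p * g * p⁻¹) = subhookChar k g := by
  simp only [subhookChar, hookChar_conj]

theorem fixCount_conj (p g : Perm α) : fixCount (p * g * p⁻¹) = fixCount g := by
  rw [fixCount, fixCount]
  refine Fintype.sum_equiv p⁻¹ _ _ fun a => ?_
  have : (p * g * p⁻¹) a = a ↔ g (p⁻¹ a) = p⁻¹ a := by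
    rw [Perm.mul_apply, Perm.mul_apply, ← Perm.eq_inv_iff_eq (f := p)]
  simp only [this]

theorem nearHookChar_conj (k : ℕ) (p g : Perm α) :
    nearHookChar k (p * g * p⁻¹) = nearHookChar k g := by
  rw [nearHookChar, fixCount_conj, subhookChar_conj, permPoly_conj, nearHookChar]

theorem sum_coeff_smul_permPoly_of_lt {k : ℕ} (h0 : 0 < k) (hk : k < Fintype.card α) :
    ∑ g : Perm α, (permPoly g).coeff k • permPoly g =
      (((Fintype.card α).factorial : ℕ) : ℝ) • (X ^ (k - 1) * (1 + X) * (1 + X)) := by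
  rw [sum_coeff_smul_permPoly, if_pos hk.le, if_neg h0.ne', if_neg (by omega)]

theorem sum_hookChar_smul_permPoly {k : ℕ} (hk : k < Fintype.card α) :
    ∑ g : Perm α, hookChar k g • permPoly g =
      (((Fintype.card α).factorial : ℕ) : ℝ) • ((1 + X) * X ^ k) := by
  induction k with
  | zero =>
    simp only [hookChar, altSum]
    rw [sum_coeff_smul_permPoly, if_pos hk.le, if_pos rfl, if_neg (by omega)]
    simp
  | succ k ih =>
    simp only [hookChar, altSum, sub_smul, Finset.sum_sub_distrib] at ih ⊢
    rw [ih (by omega), sum_coeff_smul_permPoly_of_lt (by omega) hk, ← smul_sub]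
    congr 1
    simp only [Nat.add_sub_cancel]
    ring

theorem sum_hookChar_mul_coeff {k : ℕ} (hk : k < Fintype.card α) (j : ℕ) :
    ∑ g : Perm α, hookChar k g * (permPoly g).coeff j =
      (Fintype.card α).factorial * ((1 + X) * X ^ k : ℝ[X]).coeff j := by
  simpa using congrArg (fun p => p.coeff j) (sum_hookChar_smul_permPoly hk)

theorem sum_hookChar_mul_hookChar {k : ℕ} (hk : k < Fintype.card α) (j : ℕ) :
    ∑ g : Perm α, hookChar k g * hookChar j g =
      if j = k then ((Fintype.card α).factorial : ℝ) else 0 := by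
  conv_lhs => simp only [hookChar.eq_1 j]
  rw [sum_mul_altSum]
  simp only [sum_hookChar_mul_coeff hk]
  rw [show (fun j => ((Fintype.card α).factorial : ℝ) * ((1 + X) * X ^ k : ℝ[X]).coeff j) =
    ((1 + X) * (C ((Fintype.card α).factorial : ℝ) * X ^ k) : ℝ[X]).coeff by
      ext; rw [← coeff_C_mul]; congr 1; ring, altSum_coeff]
  simp [coeff_X_pow]

theorem sum_coeff_mul_coeff {k : ℕ} (h0 : 0 < k) (hk : k < Fintype.card α) (j : ℕ) :
    ∑ g : Perm α, (permPoly g).coeff k * (permPoly g).coeff j =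
      (Fintype.card α).factorial * (X ^ (k - 1) * (1 + X) * (1 + X) : ℝ[X]).coeff j := by
  simpa using congrArg (fun p => p.coeff j) (sum_coeff_smul_permPoly_of_lt h0 hk)

theorem sum_fixCount_mul_subhookChar_mul_coeff {m k : ℕ} (hk : k < m) (j : ℕ) :
    ∑ g : Perm (Fin (m + 1)), fixCount g * subhookChar k g * (permPoly g).coeff j =
      (m + 1).factorial * (X ^ k * (1 + X) * (1 + X) : ℝ[X]).coeff j := by
  have h := sum_fixCount_smul (F := fun g : Perm (Fin (m + 1)) =>
    subhookChar k g * (permPoly g).coeff j) (by simp [subhookChar_conj, permPoly_conj])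
  have h2 := congrArg (fun p => ((1 + X) * p).coeff j)
    (sum_hookChar_smul_permPoly (α := Fin m) (k := k) (by simpa using hk))
  simp only [Finset.mul_sum, finsetSum_coeff, mul_smul_comm, coeff_smul, smul_eq_mul,
    Fintype.card_fin] at h2
  simp only [smul_eq_mul, subhookChar_stabHom, permPoly_stabHom, ← mul_assoc] at h h2
  rw [h, h2, Nat.factorial_succ]
  push_cast
  rw [show (X ^ k * (1 + X) * (1 + X) : ℝ[X]) = (1 + X) * (1 + X) * X ^ k by ring]
  ring

theorem sum_fixCount_mul_subhookChar_mul_self {m k : ℕ} (h0 : 0 < k) (hk : k < m) (l : ℕ) :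
    ∑ g : Perm (Fin (m + 2)), fixCount g * subhookChar k g * (fixCount g * subhookChar l g) =
      (m + 2).factorial * ((if l = k then 1 else 0) +
        (X ^ (k - 1) * (1 + X) * (1 + X) : ℝ[X]).coeff l) := by
  have h := sum_fixCount_smul (F := fun g : Perm (Fin (m + 2)) =>
    subhookChar k g * (fixCount g * subhookChar l g))
    (by simp [subhookChar_conj, fixCount_conj])
  have h2 := sum_fixCount_smul (F := fun g : Perm (Fin (m + 1)) =>
    hookChar k g * hookChar l g) (by simp [hookChar_conj])
  have h3 := sum_hookChar_mul_hookChar (α := Fin (m + 1)) (k := k) (by simp; omega) l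
  have h4 := sum_coeff_mul_coeff (α := Fin m) h0 (by simpa using hk) l
  simp only [Fintype.card_fin] at h3 h4
  simp only [smul_eq_mul, hookChar_stabHom, h4] at h2
  have h5 : ∑ g : Perm (Fin (m + 1)),
      hookChar k g * ((fixCount g + 1) * hookChar l g) =
      ∑ g : Perm (Fin (m + 1)), fixCount g * (hookChar k g * hookChar l g) +
      ∑ g : Perm (Fin (m + 1)), hookChar k g * hookChar l g := by
    rw [← Finset.sum_add_distrib]
    exact Finset.sum_congr rfl fun g _ => by ring
  simp only [smul_eq_mul, subhookChar_stabHom, fixCount_stabHom, h5, h2, h3] at h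
  simp only [mul_assoc] at h ⊢
  rw [h, Nat.factorial_succ (m + 1), Nat.factorial_succ m]
  push_cast
  split_ifs <;> ring

/-- Orthonormality of the near-hook characters. -/
theorem sum_nearHookChar_mul_nearHookChar {m k l : ℕ} (hk0 : 0 < k) (hk : k < m) (hl0 : 0 < l)
    (hl : l < m) :
    ∑ g : Perm (Fin (m + 2)), nearHookChar k g * nearHookChar l g =
      if l = k then ((m + 2).factorial : ℝ) else 0 := by
  have h1 := sum_fixCount_mul_subhookChar_mul_self hk0 hk l
  have h2 := sum_fixCount_mul_subhookChar_mul_coeff (m := m + 1) (k := k) (by omega) (l + 1)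
  have h3 := sum_fixCount_mul_subhookChar_mul_coeff (m := m + 1) (k := l) (by omega) (k + 1)
  have h4 := sum_coeff_mul_coeff (α := Fin (m + 2)) (k := k + 1) (by omega) (by simp; omega)
    (l + 1)
  have h5 := sum_coeff_mul_coeff (α := Fin (m + 2)) (k := l + 1) (by omega) (by simp; omega)
    (k + 1)
  simp only [Fintype.card_fin, Nat.add_sub_cancel] at h4 h5
  have h6 : (X ^ k * (1 + X) * (1 + X) : ℝ[X]).coeff (l + 1) =
      (X ^ (k - 1) * (1 + X) * (1 + X) : ℝ[X]).coeff l := by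
    rw [← coeff_mul_X (X ^ (k - 1) * (1 + X) * (1 + X) : ℝ[X]), mul_right_comm _ _ X,
      mul_right_comm _ _ X, pow_sub_one_mul hk0.ne']
  have h7 : ∑ g : Perm (Fin (m + 2)), nearHookChar k g * nearHookChar l g =
      ∑ g : Perm (Fin (m + 2)), fixCount g * subhookChar k g * (fixCount g * subhookChar l g) -
      ∑ g : Perm (Fin (m + 2)), fixCount g * subhookChar k g * (permPoly g).coeff (l + 1) -
      ∑ g : Perm (Fin (m + 2)), fixCount g * subhookChar l g * (permPoly g).coeff (k + 1) +
      ∑ g : Perm (Fin (m + 2)), (permPoly g).coeff (l + 1) * (permPoly g).coeff (k + 1) := by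
    rw [← Finset.sum_sub_distrib, ← Finset.sum_sub_distrib, ← Finset.sum_add_distrib]
    exact Finset.sum_congr rfl fun g _ => by rw [nearHookChar, nearHookChar]; ring
  rw [h7, h1, h2, h3, h5, h6]
  split_ifs <;> ring

theorem sum_nearHookChar_mul_coeff {m k j : ℕ} (hk : k < m)
    (hj : (X ^ k * (1 + X) * (1 + X) : ℝ[X]).coeff j = 0) :
    ∑ g : Perm (Fin (m + 2)), nearHookChar k g * (permPoly g).coeff j = 0 := by
  have h2 := sum_fixCount_mul_subhookChar_mul_coeff (m := m + 1) (k := k) (by omega) j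
  have h4 := sum_coeff_mul_coeff (α := Fin (m + 2)) (k := k + 1) (by omega) (by simp; omega) j
  simp only [nearHookChar, sub_mul, Finset.sum_sub_distrib, h2, h4, Nat.add_sub_cancel, hj]
  simp

end

section

open Polynomial

variable {α : Type*} [Fintype α] [DecidableEq α]

theorem hookChar_one {m : ℕ} (k : ℕ) : hookChar k (1 : Perm (Fin (m + 1))) = m.choose k := by
  rw [hookChar, permPoly_one, Fintype.card_fin, pow_succ', altSum_coeff, coeff_one_add_X_pow]

theorem subhookChar_one {m : ℕ} (k : ℕ) :
    subhookChar k (1 : Perm (Fin (m + 2))) = m.choose k := by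
  rw [← map_one (stabHom (m + 1)), subhookChar_stabHom, hookChar_one]

theorem fixCount_one : fixCount (1 : Perm α) = Fintype.card α := by
  simp [fixCount]

theorem nearHookChar_one {m : ℕ} (k : ℕ) :
    nearHookChar k (1 : Perm (Fin (m + 2))) = (m + 2) * m.choose k - (m + 2).choose (k + 1) := by
  rw [nearHookChar, subhookChar_one, fixCount_one, permPoly_one, Fintype.card_fin,
    coeff_one_add_X_pow]
  push_cast
  rfl

theorem permPoly_coeff_zero (g : Perm α) : (permPoly g).coeff 0 = 1 := by
  simp [permPoly_coeff, permMinor]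

theorem permPoly_coeff_one (g : Perm α) : (permPoly g).coeff 1 = fixCount g := by
  rw [permPoly, Matrix.coeff_det_one_add_X_smul_one, Matrix.trace, fixCount]
  simp [PEquiv.toMatrix_apply]

theorem permPoly_coeff_card (g : Perm α) :
    (permPoly g).coeff (Fintype.card α) = (Perm.sign g : ℤ) := by
  rw [permPoly_coeff, ← Finset.card_univ, Finset.powersetCard_self, Finset.sum_singleton,
    permMinor, ← Matrix.det_permutation]
  exact Matrix.det_submatrix_equiv_self (Equiv.subtypeUnivEquiv Finset.mem_univ) _

theorem permMinor_eq_zero_of_isCycle {h : Perm α} (hc : h.IsCycle)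
    (hs : h.support.card + 1 = Fintype.card α) {A : Finset α} (h2 : 2 ≤ A.card)
    (hA : A.card + 2 ≤ Fintype.card α) : permMinor h A = 0 := by
  by_contra h0
  have hinv : ∀ a ∈ A, h a ∈ A := fun a ha => by
    by_contra hna
    exact h0 (permMinor_eq_zero ha hna)
  obtain ⟨a, haA, has⟩ : ∃ a ∈ A, a ∈ h.support := by
    by_contra! hn
    have := Finset.card_le_card (fun x hx => Finset.mem_compl.2 (hn x hx) : A ⊆ h.supportᶜ)
    rw [Finset.card_compl] at this
    omega
  have hpow (i : ℕ) : (h ^ i) a ∈ A := by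
    induction i with
    | zero => exact haA
    | succ i ih => rw [pow_succ', Perm.mul_apply]; exact hinv _ ih
  have hsub : h.support ⊆ A := fun b hb => by
    obtain ⟨i, rfl⟩ := hc.exists_pow_eq (Perm.mem_support.1 has) (Perm.mem_support.1 hb)
    exact hpow i
  have := Finset.card_le_card hsub
  omega

theorem permPoly_coeff_of_isCycle {h : Perm α} (hc : h.IsCycle)
    (hs : h.support.card + 1 = Fintype.card α) {k : ℕ} (h2 : 2 ≤ k)
    (hk : k + 2 ≤ Fintype.card α) : (permPoly h).coeff k = 0 := by
  rw [permPoly_coeff]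
  refine Finset.sum_eq_zero fun A hA => ?_
  obtain rfl := (Finset.mem_powersetCard.1 hA).2
  exact permMinor_eq_zero_of_isCycle hc hs h2 hk

theorem fixCount_of_support {h : Perm α} (hs : h.support.card + 1 = Fintype.card α) :
    fixCount h = 1 := by
  have h1 : (Finset.univ.filter fun a => h a = a) = h.supportᶜ := by
    ext a; simp
  rw [fixCount, Finset.sum_boole, h1, Finset.card_compl, ← hs]
  simp

theorem hookChar_of_isCycle {h : Perm α} (hc : h.IsCycle)
    (hs : h.support.card + 1 = Fintype.card α) {k : ℕ} (hk0 : 0 < k)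
    (hk : k + 2 ≤ Fintype.card α) : hookChar k h = 0 := by
  induction k with
  | zero => omega
  | succ k ih =>
    rcases k with _ | k
    · simp only [hookChar, altSum]
      rw [permPoly_coeff_zero, permPoly_coeff_one, fixCount_of_support hs, sub_self]
    · have := ih (by omega) (by omega)
      rw [hookChar] at this ⊢
      rw [altSum, this, permPoly_coeff_of_isCycle hc hs (by omega) hk, sub_zero]

theorem subhookChar_of_isCycle {h : Perm α} (hc : h.IsCycle)
    (hs : h.support.card + 1 = Fintype.card α) {k : ℕ}
    (hk : k + 2 ≤ Fintype.card α) : subhookChar k h = (-1) ^ k := by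
  induction k with
  | zero => simp [subhookChar, hookChar, altSum, permPoly_coeff_zero]
  | succ k ih =>
    have := ih (by omega)
    rw [subhookChar] at this ⊢
    rw [altSum, this, hookChar_of_isCycle hc hs (by omega) hk]
    ring

theorem nearHookChar_of_isCycle {h : Perm α} (hc : h.IsCycle)
    (hs : h.support.card + 1 = Fintype.card α) {k : ℕ} (hk0 : 0 < k)
    (hk : k + 3 ≤ Fintype.card α) : nearHookChar k h = (-1) ^ k := by
  rw [nearHookChar, fixCount_of_support hs, subhookChar_of_isCycle hc hs (by omega),
    permPoly_coeff_of_isCycle hc hs (by omega) (by omega), sub_zero, one_mul]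

open Classical in
theorem card_isConj_mul_of_isCycle {h : Perm α} (hc : h.IsCycle)
    (hs : h.support.card + 1 = Fintype.card α) :
    (Finset.univ.filter fun g => IsConj h g).card * (Fintype.card α - 1) =
      (Fintype.card α).factorial := by
  have h1 := Perm.card_of_cycleType (α := α) {h.support.card}
  have h2 := hc.two_le_card_support
  rw [if_pos (by simpa using ⟨by omega, h2⟩)] at h1
  have h3 : (Finset.univ.filter fun g => IsConj h g) =
      Finset.univ.filter fun g : Perm α => g.cycleType = {h.support.card} := by
    ext g
    rw [Finset.mem_filter, Finset.mem_filter, Perm.isConj_iff_cycleType_eq, hc.cycleType,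
      eq_comm (a := g.cycleType)]
  rw [h3, h1]
  simp only [Multiset.sum_singleton, Multiset.prod_singleton, Multiset.toFinset_singleton,
    Finset.prod_singleton, Multiset.count_singleton_self, Nat.factorial_one, mul_one]
  rw [← hs]
  simp only [Nat.add_sub_cancel, Nat.add_sub_cancel_left, Nat.factorial_one, one_mul]
  exact Nat.div_mul_cancel (Dvd.dvd.trans (Nat.dvd_factorial (by omega) (Nat.le_succ _)) dvd_rfl)

end

/-- Two class functions of norm one with integral inner product are orthogonal or agree up to
sign. -/
theorem eq_zero_or_eq_of_integral_inner {G : Type*} [Fintype G] {φ χ : G → ℝ} {N : ℝ} (hN : 0 < N)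
    (hφ : ∑ g, φ g * φ g = N) (hχ : ∑ g, χ g * χ g = N) {z : ℤ} (hz : ∑ g, φ g * χ g = N * z)
    {a : G} (hφa : 0 < φ a) (hχa : 0 < χ a) : z = 0 ∨ χ = φ := by
  have h1 : ∑ g, (φ g - z * χ g) ^ 2 = N * (1 - z ^ 2) := by
    have : ∑ g, (φ g - z * χ g) ^ 2 =
        ∑ g, φ g * φ g - 2 * z * ∑ g, φ g * χ g + z ^ 2 * ∑ g, χ g * χ g := by
      rw [Finset.mul_sum, Finset.mul_sum, ← Finset.sum_sub_distrib, ← Finset.sum_add_distrib]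
      exact Finset.sum_congr rfl fun g _ => by ring
    rw [this, hφ, hχ, hz]
    ring
  by_cases h0 : z = 0
  · exact Or.inl h0
  have h2 : (1 : ℝ) ≤ z ^ 2 := by
    have : 0 < z ^ 2 := by positivity
    exact_mod_cast this
  have h3 : ∑ g, (φ g - z * χ g) ^ 2 = 0 :=
    le_antisymm (by rw [h1]; nlinarith) (Finset.sum_nonneg fun g _ => sq_nonneg _)
  have h4 (g : G) : φ g = z * χ g := by
    have := (Finset.sum_eq_zero_iff_of_nonneg fun g _ => sq_nonneg (φ g - z * χ g)).1 h3 g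
      (Finset.mem_univ g)
    have := pow_eq_zero_iff (two_ne_zero) |>.1 this
    linarith
  have h5 : (z : ℝ) ^ 2 = 1 := by
    have := h1.symm.trans h3
    rcases mul_eq_zero.1 this with h | h <;> linarith
  have h6 : (0 : ℝ) < z := by
    have := h4 a ▸ hφa
    exact (pos_iff_pos_of_mul_pos this).2 hχa
  have h7 : (z : ℝ) = 1 := by nlinarith
  exact Or.inr (funext fun g => by rw [h4 g, h7, one_mul])

open Classical in
/-- The equality case of Bessel's inequality for the indicator function of a conjugacy class. -/
theorem apply_eq_zero_of_orthogonal {G ι : Type*} [Group G] [Fintype G] (s : Finset ι)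
    {φ : ι → G → ℝ} {χ : G → ℝ} {N : ℝ} (hN : 0 < N) (h : G)
    (hφc : ∀ i ∈ s, ∀ p g, φ i (p * g * p⁻¹) = φ i g) (hχc : ∀ p g, χ (p * g * p⁻¹) = χ g)
    (hφ : ∀ i ∈ s, ∀ j ∈ s, ∑ g, φ i g * φ j g = if i = j then N else 0)
    (hφh : ((Finset.univ.filter fun g => IsConj h g).card : ℝ) * ∑ i ∈ s, φ i h ^ 2 = N)
    (hχ : ∀ i ∈ s, ∑ g, φ i g * χ g = 0) : χ h = 0 := by
  set c : ℝ := ((Finset.univ.filter fun g => IsConj h g).card : ℝ) with hc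
  set S := ∑ i ∈ s, φ i h ^ 2 with hS
  let δ : G → ℝ := fun g => if IsConj h g then 1 else 0
  let T : G → ℝ := fun g => ∑ i ∈ s, φ i h * φ i g
  have hδ (f : G → ℝ) (hf : ∀ p g, f (p * g * p⁻¹) = f g) : ∑ g, δ g * f g = c * f h := by
    have (g : G) : δ g * f g = if IsConj h g then f h else 0 := by
      simp only [δ]
      split_ifs with hg
      · obtain ⟨p, rfl⟩ := isConj_iff.1 hg
        rw [hf, one_mul]
      · rw [zero_mul]
    simp only [this]
    rw [← Finset.sum_filter, Finset.sum_const, nsmul_eq_mul]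
  have hT : ∀ p g, T (p * g * p⁻¹) = T g := fun p g =>
    Finset.sum_congr rfl fun i hi => by rw [hφc i hi]
  have hTh : T h = S := Finset.sum_congr rfl fun i _ => by ring
  have hTT : ∑ g, T g * T g = N * S := by
    simp only [T, Finset.sum_mul_sum]
    rw [Finset.sum_comm, hS, Finset.mul_sum]
    refine Finset.sum_congr rfl fun i hi => ?_
    rw [Finset.sum_comm]
    have (j : ι) (hj : j ∈ s) : ∑ g, φ i h * φ i g * (φ j h * φ j g) =
        if i = j then N * φ i h ^ 2 else 0 := by
      have h1 : ∑ g, φ i h * φ i g * (φ j h * φ j g) = φ i h * φ j h * ∑ g, φ i g * φ j g := by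
        rw [Finset.mul_sum]
        exact Finset.sum_congr rfl fun g _ => by ring
      rw [h1, hφ i hi j hj]
      split_ifs with hij
      · subst hij; ring
      · ring
    rw [Finset.sum_congr rfl this, Finset.sum_ite_eq, if_pos hi]
  have hδc : ∀ p g, δ (p * g * p⁻¹) = δ g := fun p g => by
    have : IsConj h (p * g * p⁻¹) ↔ IsConj h g :=
      ⟨fun h1 => h1.trans (isConj_iff.2 ⟨p, rfl⟩).symm, fun h1 => h1.trans (isConj_iff.2 ⟨p, rfl⟩)⟩
    simp only [δ, this]
  have hδh : δ h = 1 := if_pos (IsConj.refl h)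
  have hzero : ∑ g, (N * δ g - c * T g) ^ 2 = 0 := by
    have : ∑ g, (N * δ g - c * T g) ^ 2 = N ^ 2 * ∑ g, δ g * δ g - 2 * N * c * ∑ g, δ g * T g
        + c ^ 2 * ∑ g, T g * T g := by
      rw [Finset.mul_sum, Finset.mul_sum, Finset.mul_sum, ← Finset.sum_sub_distrib,
        ← Finset.sum_add_distrib]
      exact Finset.sum_congr rfl fun g _ => by ring
    rw [this, hδ δ hδc, hδ T hT, hTT, hδh, hTh]
    linear_combination (-N * c) * hφh
  have hpt (g : G) : N * δ g = c * T g := by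
    have := (Finset.sum_eq_zero_iff_of_nonneg fun g _ => sq_nonneg (N * δ g - c * T g)).1 hzero g
      (Finset.mem_univ g)
    have := pow_eq_zero_iff (two_ne_zero) |>.1 this
    linarith
  have hTχ : ∑ g, T g * χ g = 0 := by
    simp only [T, Finset.sum_mul]
    rw [Finset.sum_comm]
    refine Finset.sum_eq_zero fun i hi => ?_
    simp only [mul_assoc]
    rw [← Finset.mul_sum, hχ i hi, mul_zero]
  have hfin : N * (c * χ h) = 0 := by
    rw [← hδ χ hχc, Finset.mul_sum]
    calc ∑ g, N * (δ g * χ g) = ∑ g, c * (T g * χ g) :=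
          Finset.sum_congr rfl fun g _ => by rw [← mul_assoc, hpt, mul_assoc]
      _ = 0 := by rw [← Finset.mul_sum, hTχ, mul_zero]
  have hc0 : c ≠ 0 := fun h0 => by
    rw [h0, zero_mul] at hφh
    exact hN.ne hφh
  simpa [hN.ne', hc0] using hfin

section

open Polynomial

variable {α : Type*} [Fintype α] [DecidableEq α] {V : Type*} [AddCommGroup V] [Module ℂ V]
  [FiniteDimensional ℂ V]

/-- The multiplicity space of the character `sign ⊗ 1` of the Young subgroup preserving `A` has
integral dimension. -/
theorem sum_permMinor_smul_character (ρ : Representation ℂ (Perm α) V) (A : Finset α) :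
    ∃ z : ℤ, ∑ g, permMinor g A • ρ.character g =
      (A.card.factorial * (Fintype.card α - A.card).factorial : ℕ) * (z : ℂ) := by
  let ψ : Representation ℂ (Perm {x // x ∈ A} × Perm {x // x ∉ A}) V :=
    { toFun := fun x => ((Perm.sign x.1 : ℤ) : ℂ) • ρ (Perm.subtypeCongrHom (· ∈ A) x)
      map_one' := by rw [map_one, map_one]; simp
      map_mul' := fun x y => by
        rw [smul_mul_smul_comm, map_mul, map_mul, Prod.fst_mul, Perm.sign_mul]
        push_cast
        rfl }
  let _ : Invertible (Nat.card (Perm {x // x ∈ A} × Perm {x // x ∉ A}) : ℂ) :=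
    invertibleOfNonzero (Nat.cast_ne_zero.2 Nat.card_pos.ne')
  have h1 := ψ.card_inv_mul_sum_char_eq_finrank
  rw [inv_mul_eq_iff_eq_mul₀ (Nat.cast_ne_zero.2 Nat.card_pos.ne')] at h1
  refine ⟨(Module.finrank ℂ ψ.invariants : ℕ), ?_⟩
  rw [sum_permMinor_smul, ← Fintype.sum_prod_type']
  have h2 : Nat.card (Perm {x // x ∈ A} × Perm {x // x ∉ A}) =
      A.card.factorial * (Fintype.card α - A.card).factorial := by
    simp [Nat.card_eq_fintype_card, Fintype.card_perm, Fintype.card_subtype_compl]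
  rw [← h2, Int.cast_natCast, ← h1]
  refine Finset.sum_congr rfl fun x _ => ?_
  have : ψ x = ((Perm.sign x.1 : ℤ) : ℂ) • ρ (Perm.subtypeCongrHom (· ∈ A) x) := rfl
  rw [Representation.character, Representation.character, this, map_smul, Complex.real_smul]
  simp only [Complex.ofReal_intCast, smul_eq_mul]
  rfl

theorem sum_coeff_smul_character (ρ : Representation ℂ (Perm α) V) (k : ℕ) :
    ∃ z : ℤ, ∑ g, (permPoly g).coeff k • ρ.character g = (Fintype.card α).factorial * (z : ℂ) := by
  simp only [permPoly_coeff, Finset.sum_smul]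
  rw [Finset.sum_comm]
  by_cases hk : k ≤ Fintype.card α
  · obtain ⟨A, hA, hAk⟩ := Finset.exists_subset_card_eq (s := (Finset.univ : Finset α)) hk
    obtain ⟨z, hz⟩ := sum_permMinor_smul_character ρ A
    refine ⟨z, ?_⟩
    have h1 : ∀ B ∈ Finset.univ.powersetCard k, ∑ g, permMinor g B • ρ.character g =
        ∑ g, permMinor g A • ρ.character g := by
      intro B hB
      obtain ⟨p, hp⟩ : ∃ p : Perm α, A.map p.toEmbedding = B := by
        have hc : Fintype.card {x // x ∈ A} = Fintype.card {x // x ∈ B} := by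
          rw [Fintype.card_coe, Fintype.card_coe, hAk, (Finset.mem_powersetCard.1 hB).2]
        let e := Fintype.equivOfCardEq hc
        refine ⟨e.extendSubtype, Finset.eq_of_subset_of_card_le ?_ ?_⟩
        · intro b hb
          obtain ⟨a, ha, rfl⟩ := Finset.mem_map.1 hb
          exact e.extendSubtype_mem a ha
        · rw [Finset.card_map, hAk, (Finset.mem_powersetCard.1 hB).2]
      symm
      refine Fintype.sum_equiv (MulAut.conj p).toEquiv _ _ fun g => ?_
      simp only [MulEquiv.toEquiv_eq_coe, MulEquiv.coe_toEquiv, MulAut.conj_apply,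
        Representation.char_conj, ← hp, permMinor_conj]
    rw [Finset.sum_congr rfl h1, Finset.sum_const, Finset.card_powersetCard, Finset.card_univ,
      hz, hAk, ← Nat.choose_mul_factorial_mul_factorial hk]
    push_cast
    rw [nsmul_eq_mul]
    ring
  · refine ⟨0, ?_⟩
    rw [Finset.powersetCard_eq_empty.2 (by simpa using hk)]
    simp

theorem sum_hookChar_smul_character (ρ : Representation ℂ (Perm α) V) (k : ℕ) :
    ∃ z : ℤ, ∑ g, hookChar k g • ρ.character g = (Fintype.card α).factorial * (z : ℂ) := by
  induction k with
  | zero => exact sum_coeff_smul_character ρ 0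
  | succ k ih =>
    obtain ⟨z, hz⟩ := ih
    obtain ⟨y, hy⟩ := sum_coeff_smul_character ρ (k + 1)
    refine ⟨y - z, ?_⟩
    simp only [hookChar, altSum, sub_smul, Finset.sum_sub_distrib] at hz hy ⊢
    rw [hz, hy]
    push_cast
    ring

theorem sum_nearHookChar_smul_character {m : ℕ} (ρ : Representation ℂ (Perm (Fin (m + 1))) V)
    (k : ℕ) :
    ∃ z : ℤ, ∑ g, nearHookChar k g • ρ.character g = (m + 1).factorial * (z : ℂ) := by
  obtain ⟨y, hy⟩ := sum_coeff_smul_character ρ (k + 1)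
  obtain ⟨z, hz⟩ := sum_hookChar_smul_character (ρ.comp (stabHom m)) k
  have h := sum_fixCount_smul (F := fun g : Perm (Fin (m + 1)) =>
    subhookChar k g • ρ.character g) (by simp [subhookChar_conj])
  refine ⟨z - y, ?_⟩
  simp only [Fintype.card_fin] at hy hz
  have hc (g : Perm (Fin m)) : Representation.character (ρ.comp (stabHom m)) g =
      ρ.character (stabHom m g) := rfl
  simp only [subhookChar_stabHom, ← hc, hz] at h
  simp only [nearHookChar, sub_smul, Finset.sum_sub_distrib, mul_smul]
  rw [h, hy, Nat.factorial_succ, Complex.real_smul]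
  push_cast
  ring

open scoped ComplexOrder in
/-- Characters of finite groups take inverses to complex conjugates. -/
theorem character_inv_eq_conj {G : Type*} [Group G] [Fintype G] (ρ : Representation ℂ G V)
    (g : G) : ρ.character g⁻¹ = starRingEnd ℂ (ρ.character g) := by
  let b := Module.finBasis ℂ V
  let M : G →* Matrix _ _ ℂ := (LinearMap.toMatrixAlgEquiv b).toMonoidHom.comp ρ
  have htr (x : G) : ρ.character x = (M x).trace := by
    rw [Representation.character, LinearMap.trace_eq_matrix_trace ℂ b]
    rfl
  let S := ∑ x, (M x).conjTranspose * M x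
  have hS : IsUnit S := by
    classical
    refine Matrix.PosDef.isUnit ?_
    have : ∑ x, (M x).conjTranspose * M x =
        1 + ∑ x ∈ Finset.univ.erase 1, (M x).conjTranspose * M x := by
      rw [← Finset.add_sum_erase Finset.univ (fun x => (M x).conjTranspose * M x)
        (Finset.mem_univ 1), map_one, mul_one, Matrix.conjTranspose_one]
    simp only [S]
    rw [this]
    exact Matrix.PosDef.one.add_posSemidef
      (Matrix.posSemidef_sum _ fun x _ => Matrix.posSemidef_conjTranspose_mul_self _)
  have hinv : S * M g⁻¹ = (M g).conjTranspose * S := by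
    have h1 : (M g).conjTranspose * S * M g = S := by
      simp only [S, Finset.mul_sum, Finset.sum_mul]
      refine Fintype.sum_equiv (Equiv.mulRight g) _ _ fun x => ?_
      rw [Equiv.coe_mulRight, map_mul, Matrix.conjTranspose_mul]
      simp only [mul_assoc]
    calc S * M g⁻¹ = (M g).conjTranspose * S * M g * M g⁻¹ := by rw [h1]
      _ = (M g).conjTranspose * S := by
        rw [mul_assoc, ← map_mul, mul_inv_cancel, map_one, mul_one]
  obtain ⟨u, hu⟩ := hS
  rw [← hu] at hinv
  have h2 : M g⁻¹ = (↑u⁻¹ : Matrix _ _ ℂ) * ((M g).conjTranspose * (u : Matrix _ _ ℂ)) := by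
    rw [← hinv, Units.inv_mul_cancel_left]
  rw [htr, htr, h2, Matrix.trace_mul_comm, mul_assoc, Units.mul_inv, mul_one,
    Matrix.trace_conjTranspose]
  rfl

end

section

open CategoryTheory

/-- The character of a representation is the sum of the characters on complementary
subrepresentations. -/
theorem character_eq_add_of_isCompl {G V : Type*} [Group G] [AddCommGroup V] [Module ℂ V]
    [FiniteDimensional ℂ V] {ρ : Representation ℂ G V} {p q : Subrepresentation ρ}
    (h : IsCompl p q) (g : G) :
    ρ.character g = p.toRepresentation.character g + q.toRepresentation.character g := by
  have h' : IsCompl p.toSubmodule q.toSubmodule := by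
    refine ⟨disjoint_iff.2 ?_, codisjoint_iff.2 ?_⟩
    · exact congrArg Subrepresentation.toSubmodule h.inf_eq_bot
    · exact congrArg Subrepresentation.toSubmodule h.sup_eq_top
  have h1 : ρ g = (Submodule.prodEquivOfIsCompl _ _ h').conj
      ((p.toRepresentation g).prodMap (q.toRepresentation g)) := by
    refine LinearMap.ext fun v => ?_
    obtain ⟨⟨a, b⟩, rfl⟩ := (Submodule.prodEquivOfIsCompl _ _ h').surjective v
    rw [LinearEquiv.conj_apply_apply, LinearEquiv.symm_apply_apply]
    simp [Subrepresentation.toRepresentation]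
  rw [Representation.character, h1, LinearMap.trace_conj', LinearMap.trace_prodMap']
  rfl

/-- A function which is not orthogonal to some character is not orthogonal to some irreducible
character. -/
theorem exists_simple_of_sum_mul_character_ne_zero {G : Type} [Group G] [Fintype G] (φ : G → ℂ)
    {V : Type} [AddCommGroup V] [Module ℂ V] [FiniteDimensional ℂ V] (ρ : Representation ℂ G V)
    (h : ∑ g, φ g * ρ.character g ≠ 0) :
    ∃ W : FDRep ℂ G, Simple W ∧ ∑ g, φ g * W.character g ≠ 0 := by
  induction hn : Module.finrank ℂ V using Nat.strong_induction_on generalizing V with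
  | _ n ih =>
    by_cases hirr : ρ.IsIrreducible
    · refine ⟨FDRep.of ρ, ?_, h⟩
      let _ : Invertible (Nat.card G : ℂ) :=
        invertibleOfNonzero (Nat.cast_ne_zero.2 Nat.card_pos.ne')
      rw [FDRep.simple_iff_char_is_norm_one]
      have h1 := ρ.card_inv_mul_sum_char_mul_char_eq_finrank ρ
      rw [Representation.IsIrreducible.finrank_intertwiningMap_self,
        inv_mul_eq_iff_eq_mul₀ (Nat.cast_ne_zero.2 Nat.card_pos.ne'), Nat.cast_one, mul_one] at h1
      exact h1
    · have hV : Nontrivial V := by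
        by_contra hV
        rw [not_nontrivial_iff_subsingleton] at hV
        refine h (Finset.sum_eq_zero fun g _ => ?_)
        rw [Representation.character, Subsingleton.elim (ρ g) 0, map_zero, mul_zero]
      have hnt : Nontrivial (Subrepresentation ρ) := by
        refine ⟨⊥, ⊤, fun hbt => ?_⟩
        exact bot_ne_top (α := Submodule ℂ V) (congrArg Subrepresentation.toSubmodule hbt)
      obtain ⟨p, hp0, hp1⟩ : ∃ p : Subrepresentation ρ, p ≠ ⊥ ∧ p ≠ ⊤ := by
        by_contra! hall
        exact hirr { eq_bot_or_eq_top := fun p => or_iff_not_imp_left.2 (hall p) }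
      obtain ⟨q, hpq⟩ := exists_isCompl p
      have hq1 : q ≠ ⊤ := fun hq => hp0 (by simpa [hq] using hpq.inf_eq_bot)
      have hlt {r : Subrepresentation ρ} (hr : r ≠ ⊤) : Module.finrank ℂ r.toSubmodule < n := by
        rw [← hn]
        exact Submodule.finrank_lt fun ht => hr (Subrepresentation.toSubmodule_injective ht)
      have hsum : ∑ g, φ g * ρ.character g = ∑ g, φ g * p.toRepresentation.character g +
          ∑ g, φ g * q.toRepresentation.character g := by
        rw [← Finset.sum_add_distrib]
        exact Finset.sum_congr rfl fun g _ => by rw [character_eq_add_of_isCompl hpq, mul_add]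
      by_cases hps : ∑ g, φ g * p.toRepresentation.character g = 0
      · refine ih _ (hlt hq1) q.toRepresentation ?_ rfl
        rwa [hsum, hps, zero_add] at h
      · exact ih _ (hlt hp1) p.toRepresentation hps rfl

/-- The regular representation on the space of functions on the group. -/
def regularRep (G : Type*) [Group G] : Representation ℂ G (G → ℂ) where
  toFun g := LinearMap.funLeft ℂ ℂ (g⁻¹ * ·)
  map_one' := by ext; simp [LinearMap.funLeft]
  map_mul' g h := by ext; simp [LinearMap.funLeft, mul_assoc]

theorem regularRep_character {G : Type*} [Group G] [Fintype G] [DecidableEq G] (g : G) :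
    (regularRep G).character g = if g = 1 then (Fintype.card G : ℂ) else 0 := by
  rw [Representation.character, LinearMap.trace_eq_matrix_trace ℂ (Pi.basisFun ℂ G), Matrix.trace]
  have (x : G) : (LinearMap.toMatrix (Pi.basisFun ℂ G) (Pi.basisFun ℂ G) (regularRep G g)).diag x =
      if g = 1 then 1 else 0 := by
    simp [regularRep, LinearMap.funLeft, Pi.single_apply]
  rw [Finset.sum_congr rfl fun x _ => this x, Finset.sum_const, Finset.card_univ]
  simp

theorem exists_simple_of_apply_one_ne_zero {G : Type} [Group G] [Fintype G] {φ : G → ℂ}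
    (h : φ 1 ≠ 0) : ∃ W : FDRep ℂ G, Simple W ∧ ∑ g, φ g * W.character g ≠ 0 := by
  classical
  refine exists_simple_of_sum_mul_character_ne_zero φ (regularRep G) ?_
  simp [regularRep_character, h]

end

section

open CategoryTheory

theorem character_real {α V : Type*} [Fintype α] [DecidableEq α] [AddCommGroup V] [Module ℂ V]
    [FiniteDimensional ℂ V] (ρ : Representation ℂ (Perm α) V) (g : Perm α) :
    ((ρ.character g).re : ℂ) = ρ.character g := by
  obtain ⟨p, hp⟩ := isConj_iff.1
    (Perm.isConj_of_cycleType_eq (Perm.cycleType_inv g).symm : IsConj g g⁻¹)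
  refine Complex.conj_eq_iff_re.1 ?_
  rw [← character_inv_eq_conj, ← hp, Representation.char_conj]

/-- The characters of the irreducible representations of symmetric groups are real class functions
of norm one which have integral inner products with the near-hook characters. -/
theorem exists_real_character {m : ℕ} (V : FDRep ℂ (Perm (Fin (m + 1)))) [Simple V] :
    ∃ χ : Perm (Fin (m + 1)) → ℝ, (∀ g, V.character g = χ g) ∧
      (∀ p g, χ (p * g * p⁻¹) = χ g) ∧ 0 < χ 1 ∧
      ∑ g, χ g * χ g = ((m + 1).factorial : ℝ) ∧
      (∀ k, ∃ z : ℤ, ∑ g, (permPoly g).coeff k * χ g = ((m + 1).factorial : ℝ) * z) ∧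
      ∀ k, ∃ z : ℤ, ∑ g, nearHookChar k g * χ g = ((m + 1).factorial : ℝ) * z := by
  have hχ (g : Perm (Fin (m + 1))) : V.character g = ((V.character g).re : ℂ) :=
    (character_real V.ρ g).symm
  have hint {f : Perm (Fin (m + 1)) → ℝ}
      (h : ∃ z : ℤ, ∑ g, f g • V.character g = ((m + 1).factorial : ℂ) * z) :
      ∃ z : ℤ, ∑ g, f g * (V.character g).re = ((m + 1).factorial : ℝ) * z := by
    obtain ⟨z, hz⟩ := h
    refine ⟨z, ?_⟩
    have := congrArg Complex.re hz
    rw [Complex.re_sum] at this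
    simpa using this
  have hcard : (Nat.card (Perm (Fin (m + 1))) : ℂ) = ((m + 1).factorial : ℂ) := by
    simp [Nat.card_eq_fintype_card, Fintype.card_perm]
  have hnorm : ∑ g, (V.character g).re * (V.character g).re = ((m + 1).factorial : ℝ) := by
    have h1 := (FDRep.simple_iff_char_is_norm_one V).1 inferInstance
    have h2 (g : Perm (Fin (m + 1))) : V.character g⁻¹ = ((V.character g).re : ℂ) := by
      rw [← hχ]
      obtain ⟨p, hp⟩ := isConj_iff.1
        (Perm.isConj_of_cycleType_eq (Perm.cycleType_inv g).symm : IsConj g g⁻¹)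
      rw [← hp, FDRep.char_conj]
    rw [hcard, Finset.sum_congr rfl fun g _ => by rw [h2, hχ g, Complex.ofReal_re]] at h1
    exact_mod_cast h1
  refine ⟨fun g => (V.character g).re, hχ, fun p g => congrArg Complex.re (V.char_conj g p), ?_,
    hnorm,
    fun k => hint ?_, fun k => hint ?_⟩
  · have h1 : V.character 1 = (Module.finrank ℂ V : ℂ) := FDRep.char_one V
    rcases Nat.eq_zero_or_pos (Module.finrank ℂ V) with h0 | h0
    · exfalso
      have hsub : Subsingleton V := Module.finrank_zero_iff.1 h0
      have h2 (g : Perm (Fin (m + 1))) : V.character g = 0 := by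
        rw [FDRep.character, Subsingleton.elim (V.ρ g) 0, map_zero]
      simp only [h2, Complex.zero_re, mul_zero, Finset.sum_const_zero] at hnorm
      exact Nat.factorial_ne_zero _ (by exact_mod_cast hnorm.symm)
    · change 0 < (V.character 1).re
      rw [h1]
      simpa using h0
  · have := sum_coeff_smul_character V.ρ k
    rw [Fintype.card_fin] at this
    exact this
  · exact sum_nearHookChar_smul_character V.ρ k

theorem le_choose {m k : ℕ} (h1 : 1 ≤ k) (h2 : k + 1 ≤ m) : m ≤ m.choose k := by
  induction m generalizing k with
  | zero => omega
  | succ m ih =>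
    obtain ⟨k, rfl⟩ := Nat.exists_eq_add_of_le' h1
    rw [Nat.choose_succ_succ']
    rcases Nat.eq_or_lt_of_le h2 with h | h
    · obtain rfl : m = k + 1 := by omega
      rw [Nat.choose_self, Nat.choose_succ_self_right]
    · have := ih h1 (by omega)
      have := Nat.choose_pos (n := m) (k := k) (by omega)
      omega

theorem choose_two_le_choose {m k : ℕ} (h1 : 2 ≤ k) (h2 : k + 2 ≤ m) :
    m.choose 2 ≤ m.choose k := by
  induction m generalizing k with
  | zero => omega
  | succ m ih =>
    obtain ⟨k, rfl⟩ := Nat.exists_eq_add_of_le' h1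
    rw [Nat.choose_succ_succ' m 1, Nat.choose_one_right, Nat.choose_succ_succ' m (k + 1)]
    rcases Nat.eq_or_lt_of_le h2 with h | h
    · obtain rfl : m = k + 1 + 2 := by omega
      rw [Nat.choose_symm_add, Nat.choose_symm_of_eq_add (n := k + 1 + 2) (a := k + 1 + 1)
        (b := 1) (by omega), Nat.choose_one_right, add_comm]
    · have := ih (k := k + 2) (by omega) (by omega)
      have := le_choose (m := m) (k := k + 1) (by omega) (by omega)
      simp only [add_assoc, Nat.reduceAdd] at *
      omega

theorem mul_nearHookChar_one {m k : ℕ} (hk : k ≤ m) :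
    ((k + 1) * (m + 1 - k) : ℝ) * nearHookChar k (1 : Perm (Fin (m + 2))) =
      (m + 2) * m.choose k * ((k + 1) * (m + 1 - k) - (m + 1)) := by
  have h1 := Nat.choose_mul_succ_eq m k
  have h2 := Nat.add_one_mul_choose_eq (m + 1) k
  zify [(by omega : k ≤ m + 1)] at h1 h2
  have h1' : (m.choose k : ℝ) * (m + 1) = (m + 1).choose k * (m + 1 - k) := by exact_mod_cast h1
  have h2' : ((m : ℝ) + 2) * (m + 1).choose k = (m + 2).choose (k + 1) * (k + 1) := by
    have : ((m : ℝ) + 1 + 1) * (m + 1).choose k = (m + 2).choose (k + 1) * (k + 1) := by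
      exact_mod_cast h2
    linarith
  rw [nearHookChar_one]
  linear_combination (m + 2 : ℝ) * h1' + (m + 1 - k : ℝ) * h2'

theorem nearHookChar_one_pos {m k : ℕ} (hk0 : 0 < k) (hk : k < m) :
    0 < nearHookChar k (1 : Perm (Fin (m + 2))) := by
  have h := mul_nearHookChar_one hk.le
  have h1 : (1 : ℝ) ≤ k := by exact_mod_cast hk0
  have h2 : (k : ℝ) + 1 ≤ m := by exact_mod_cast hk
  have h3 : (0 : ℝ) < m.choose k := by exact_mod_cast Nat.choose_pos hk.le
  have h4 : (0 : ℝ) < (k + 1) * (m + 1 - k) := by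
    apply mul_pos <;> linarith
  refine (pos_iff_pos_of_mul_pos ?_).1 h4
  rw [h]
  refine mul_pos (by positivity) ?_
  nlinarith [mul_nonneg (sub_nonneg.2 h1) (sub_nonneg.2 h2)]

theorem le_nearHookChar_one {m k : ℕ} (hk0 : 2 ≤ k) (hk : k + 2 ≤ m) :
    ((m + 2) * m * (m - 2) / 3 : ℝ) ≤ nearHookChar k (1 : Perm (Fin (m + 2))) := by
  have h := mul_nearHookChar_one (m := m) (k := k) (by omega)
  have h1 : (2 : ℝ) ≤ k := by exact_mod_cast hk0
  have h2 : (k : ℝ) + 2 ≤ m := by exact_mod_cast hk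
  have h3 : (m : ℝ) * (m - 1) / 2 ≤ m.choose k := by
    rw [← Nat.cast_choose_two]
    exact_mod_cast choose_two_le_choose hk0 hk
  have h4 : 3 * (m - 1) ≤ ((k + 1) * (m + 1 - k) : ℝ) := by
    nlinarith [mul_nonneg (sub_nonneg.2 h1) (sub_nonneg.2 h2)]
  set q := ((k + 1) * (m + 1 - k) : ℝ)
  have hq : 0 < q := by linarith
  refine le_of_mul_le_mul_left ?_ hq
  rw [h]
  have h5 : (m + 2) * (m * (m - 1) / 2) * (q - (m + 1)) ≤ (m + 2) * m.choose k * (q - (m + 1)) := by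
    gcongr
    linarith
  refine le_trans ?_ h5
  have h6 : 0 ≤ (m + 2) * m * (m + 1) * (q - 3 * (m - 1)) / 6 := by
    have : 0 ≤ q - 3 * (m - 1) := by linarith
    positivity
  linarith

theorem nearHookChar_two_one {m : ℕ} (hm : 2 ≤ m) :
    nearHookChar 2 (1 : Perm (Fin (m + 2))) = (m + 2) * m * (m - 2) / 3 := by
  have h := mul_nearHookChar_one hm
  rw [Nat.cast_choose_two] at h
  have h0 : ((m : ℝ) - 1) ≠ 0 := by
    have : (2 : ℝ) ≤ m := by exact_mod_cast hm
    linarith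
  refine mul_left_cancel₀ (mul_ne_zero (by norm_num : (3 : ℝ) ≠ 0) h0) ?_
  push_cast at h
  linear_combination h

theorem nearHookChar_last_one {m : ℕ} (hm : 1 ≤ m) :
    nearHookChar (m - 1) (1 : Perm (Fin (m + 2))) = (m + 2) * (m - 1) / 2 := by
  obtain ⟨m, rfl⟩ := Nat.exists_eq_add_of_le' hm
  rw [nearHookChar_one, Nat.add_sub_cancel, Nat.choose_succ_self_right,
    Nat.choose_symm_of_eq_add (n := m + 1 + 2) (a := m + 1) (b := 2) (by omega),
    Nat.cast_choose_two]
  push_cast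
  ring

end

section

open CategoryTheory

theorem exists_simple_character_eq_nearHookChar {m k : ℕ} (hk0 : 0 < k) (hk : k < m) :
    ∃ V : FDRep ℂ (Perm (Fin (m + 2))), Simple V ∧ ∀ g, V.character g = (nearHookChar k g : ℂ) := by
  have hpos := nearHookChar_one_pos hk0 hk
  obtain ⟨V, hV, h⟩ := exists_simple_of_apply_one_ne_zero
    (φ := fun g : Perm (Fin (m + 2)) => (nearHookChar k g : ℂ)) (by exact_mod_cast hpos.ne')
  obtain ⟨χ, hχ, -, hχ1, hnorm, -, hint⟩ := exists_real_character V
  obtain ⟨z, hz⟩ := hint k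
  refine ⟨V, hV, fun g => ?_⟩
  rcases eq_zero_or_eq_of_integral_inner (by positivity)
    ((sum_nearHookChar_mul_nearHookChar hk0 hk hk0 hk).trans (if_pos rfl)) hnorm hz hpos hχ1
    with rfl | rfl
  · refine absurd ?_ h
    simp only [hχ]
    rw [Int.cast_zero, mul_zero] at hz
    exact_mod_cast hz
  · exact hχ g

/-- The trivial character, the near-hook characters and the sign character. -/
noncomputable def smallRankChar (m i : ℕ) (g : Perm (Fin (m + 2))) : ℝ :=
  if i = 0 then (permPoly g).coeff 0 else if i = m then (permPoly g).coeff (m + 2)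
  else nearHookChar i g

theorem sum_smallRankChar_mul {m i j : ℕ} (hm : 0 < m) (hi : i ≤ m) (hj : j ≤ m) :
    ∑ g, smallRankChar m i g * smallRankChar m j g =
      if i = j then ((m + 2).factorial : ℝ) else 0 := by
  have hsign (g : Perm (Fin (m + 2))) : (permPoly g).coeff (m + 2) = (Perm.sign g : ℤ) := by
    simpa using permPoly_coeff_card g
  have hs : ∑ g : Perm (Fin (m + 2)), (permPoly g).coeff (m + 2) = 0 := by
    simp_rw [hsign]
    rw [sum_sign, if_neg (by simp)]
  have hss : ∑ g : Perm (Fin (m + 2)), (permPoly g).coeff (m + 2) * (permPoly g).coeff (m + 2) =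
      ((m + 2).factorial : ℝ) := by
    simp_rw [hsign, ← Int.cast_mul, Int.units_coe_mul_self]
    simp [Fintype.card_perm]
  have h0 {k : ℕ} (hk0 : 0 < k) (hk : k < m) :
      ∑ g : Perm (Fin (m + 2)), nearHookChar k g * (permPoly g).coeff 0 = 0 := by
    refine sum_nearHookChar_mul_coeff hk ?_
    rw [mul_assoc, Polynomial.coeff_X_pow_mul', if_neg (by omega)]
  have h1 {k : ℕ} (hk : k < m) :
      ∑ g : Perm (Fin (m + 2)), nearHookChar k g * (permPoly g).coeff (m + 2) = 0 := by
    refine sum_nearHookChar_mul_coeff hk (Polynomial.coeff_eq_zero_of_natDegree_lt ?_)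
    refine lt_of_le_of_lt (b := k + 2) ?_ (by omega)
    compute_degree
  unfold smallRankChar
  rcases eq_or_ne i 0 with rfl | hi0 <;> rcases eq_or_ne j 0 with rfl | hj0
  · simp [permPoly_coeff_zero, Fintype.card_perm]
  · rw [if_neg hj0.symm]
    by_cases hjm : j = m
    · simpa [hj0, hjm, hm.ne', permPoly_coeff_zero] using hs
    · simpa [hj0, hjm, mul_comm] using h0 (Nat.pos_of_ne_zero hj0) (by omega)
  · rw [if_neg hi0]
    by_cases him : i = m
    · simpa [hi0, him, hm.ne', permPoly_coeff_zero] using hs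
    · simpa [hi0, him] using h0 (Nat.pos_of_ne_zero hi0) (by omega)
  · by_cases him : i = m <;> by_cases hjm : j = m
    · simpa [him, hjm, hm.ne'] using hss
    · simpa [him, hjm, hm.ne', hj0, Ne.symm hjm, mul_comm] using h1 (k := j) (by omega)
    · simpa [him, hjm, hm.ne', hi0] using h1 (k := i) (by omega)
    · simp only [hi0, hj0, him, hjm, if_false]
      rw [sum_nearHookChar_mul_nearHookChar (by omega) (by omega) (by omega) (by omega)]
      simp only [eq_comm]

theorem smallRankChar_conj {m i : ℕ} (p g : Perm (Fin (m + 2))) :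
    smallRankChar m i (p * g * p⁻¹) = smallRankChar m i g := by
  simp only [smallRankChar, permPoly_conj, nearHookChar_conj]

theorem smallRankChar_sq_of_isCycle {m i : ℕ} (hi : i ≤ m) {h : Perm (Fin (m + 2))}
    (hc : h.IsCycle) (hs : h.support.card = m + 1) : smallRankChar m i h ^ 2 = 1 := by
  unfold smallRankChar
  split_ifs with h0 h1
  · rw [permPoly_coeff_zero, one_pow]
  · have := permPoly_coeff_card h
    rw [Fintype.card_fin] at this
    rw [this, sq, ← Int.cast_mul, Int.units_coe_mul_self, Int.cast_one]
  · rw [nearHookChar_of_isCycle hc (by simpa using hs) (by omega) (by simp; omega), ← pow_mul,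
      mul_comm, pow_mul]
    simp

theorem smallRankChar_one_pos {m i : ℕ} (hi : i ≤ m) :
    0 < smallRankChar m i 1 := by
  unfold smallRankChar
  split_ifs with h0 h1
  · rw [permPoly_coeff_zero]
    exact one_pos
  · have := permPoly_coeff_card (1 : Perm (Fin (m + 2)))
    rw [Fintype.card_fin] at this
    simp [this]
  · exact nearHookChar_one_pos (by omega) (by omega)

theorem character_of_isCycle {m : ℕ} (hm : 0 < m) (V : FDRep ℂ (Perm (Fin (m + 2)))) [Simple V]
    {h : Perm (Fin (m + 2))} (hc : h.IsCycle) (hs : h.support.card = m + 1) :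
    V.character 1 = 1 ∨ V.character h = 0 ∨
      ∃ k, 0 < k ∧ k < m ∧ ∀ g, V.character g = (nearHookChar k g : ℂ) := by
  classical
  obtain ⟨χ, hχ, hχc, hχ1, hnorm, hint, hint'⟩ := exists_real_character V
  simp only [hχ]
  by_cases hex : ∃ i ≤ m, χ = smallRankChar m i
  · obtain ⟨i, hi, rfl⟩ := hex
    rcases eq_or_ne i 0 with rfl | hi0
    · left
      simp [smallRankChar, permPoly_coeff_zero]
    · rcases eq_or_ne i m with rfl | him
      · left
        have := permPoly_coeff_card (1 : Perm (Fin (i + 2)))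
        rw [Fintype.card_fin] at this
        simp [smallRankChar, hi0, this]
      · exact .inr (.inr ⟨i, by omega, by omega, fun g => by simp [smallRankChar, hi0, him]⟩)
  · right; left
    refine Complex.ofReal_eq_zero.2 (apply_eq_zero_of_orthogonal (N := ((m + 2).factorial : ℝ))
      (Finset.range (m + 1)) (φ := smallRankChar m) (by positivity) h
      (fun i _ => smallRankChar_conj) hχc (fun i hi j hj => ?_) ?_ fun i hi => ?_)
    · rw [sum_smallRankChar_mul hm (Finset.mem_range_succ_iff.1 hi)
        (Finset.mem_range_succ_iff.1 hj)]
      congr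
    · rw [Finset.sum_congr rfl fun i hi =>
        smallRankChar_sq_of_isCycle (Finset.mem_range_succ_iff.1 hi) hc hs]
      have := card_isConj_mul_of_isCycle hc (by simpa using hs)
      rw [Fintype.card_fin, Nat.add_sub_cancel_right (n := m + 1) (m := 1)] at this
      rw [Finset.sum_const, Finset.card_range, nsmul_eq_mul, mul_one, Nat.succ_eq_add_one,
        ← Nat.cast_mul, ← this]
      congr!
    · have hi' := Finset.mem_range_succ_iff.1 hi
      have : ∃ z : ℤ, ∑ g, smallRankChar m i g * χ g = ((m + 2).factorial : ℝ) * z := by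
        unfold smallRankChar
        split_ifs
        exacts [hint 0, hint _, hint' i]
      obtain ⟨z, hz⟩ := this
      rcases eq_zero_or_eq_of_integral_inner (by positivity)
        ((sum_smallRankChar_mul hm hi' hi').trans (if_pos rfl)) hnorm hz
        (smallRankChar_one_pos hi') hχ1 with rfl | h'
      · simpa using hz
      · exact absurd ⟨i, hi', h'⟩ hex

end

section

open CategoryTheory

theorem isGreatest_character_div {m k₀ : ℕ} {c : ℝ} {h : Perm (Fin (m + 2))}
    (hc : h.IsCycle) (hs : h.support.card = m + 1)
    (hle : ∀ k, 0 < k → k < m → Even k → 1 ≤ c * nearHookChar k (1 : Perm (Fin (m + 2))))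
    (h0 : 0 < k₀) (hk₀ : k₀ < m) (heven : Even k₀)
    (heq : c * nearHookChar k₀ (1 : Perm (Fin (m + 2))) = 1)
    (hne : nearHookChar k₀ (1 : Perm (Fin (m + 2))) ≠ 1) :
    IsGreatest {t : ℝ | ∃ V : FDRep ℂ (Perm (Fin (m + 2))), Simple V ∧
      V.character 1 ≠ 1 ∧ V.character h / V.character 1 = (t : ℂ)} c := by
  have hval {k : ℕ} (hk0 : 0 < k) (hk : k < m) : nearHookChar k h = (-1) ^ k :=
    nearHookChar_of_isCycle hc (by simpa using hs) hk0 (by simpa using hk)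
  have hc0 : 0 ≤ c := by
    have := nearHookChar_one_pos h0 hk₀
    exact (pos_of_mul_pos_left (heq ▸ one_pos) this.le).le
  constructor
  · obtain ⟨V, hV, hχ⟩ := exists_simple_character_eq_nearHookChar h0 hk₀
    refine ⟨V, hV, by rw [hχ]; exact_mod_cast hne, ?_⟩
    rw [hχ, hχ, hval h0 hk₀, heven.neg_one_pow, ← Complex.ofReal_div, Complex.ofReal_inj,
      eq_comm]
    exact eq_one_div_of_mul_eq_one_left heq
  · rintro t ⟨V, hV, hV1, ht⟩
    rcases character_of_isCycle (by omega) V hc hs with h1 | h1 | ⟨k, hk0, hk, hχ⟩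
    · exact absurd h1 hV1
    · rw [h1, zero_div, eq_comm, Complex.ofReal_eq_zero] at ht
      rwa [ht]
    · rw [hχ, hχ, ← Complex.ofReal_div, Complex.ofReal_inj, hval hk0 hk] at ht
      have hpos := nearHookChar_one_pos hk0 hk
      rw [← ht, div_le_iff₀ hpos]
      rcases Nat.even_or_odd k with he | ho
      · rw [he.neg_one_pow]
        exact hle k hk0 hk he
      · rw [ho.neg_one_pow]
        linarith [mul_nonneg hc0 hpos.le]

end

/-- Let `n > 4` and let `h ∈ S_n` be an `(n-1)`-cycle with conjugacy class `H`,
`|H| = n·(n-2)!`.  (1) If `n` is even, the maximum of `χ(h)/χ(1)` over irreducible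
complex characters `χ` of `S_n` with `χ(1) ≠ 1` equals `3/(n(n-2)(n-4))`, and the
corresponding eigenvalue `|H|·3/(n(n-2)(n-4))` of `H⁺` equals `3(n-3)·(n-5)!`.
(2) If `n` is odd, this maximum equals `2/(n(n-3))` and the corresponding eigenvalue
equals `2(n-2)·(n-4)!`. -/
theorem stmt12 (n : ℕ) (hn : 4 < n) (h : Perm (Fin n))
    (hcyc : h.IsCycle) (hsupp : h.support.card = n - 1) :
    (Even n →
      IsGreatest
        {t : ℝ | ∃ V : FDRep ℂ (Perm (Fin n)), CategoryTheory.Simple V ∧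
          V.character 1 ≠ 1 ∧ V.character h / V.character 1 = (t : ℂ)}
        (3 / ((n : ℝ) * ((n : ℝ) - 2) * ((n : ℝ) - 4))) ∧
      ((n * (n - 2).factorial : ℕ) : ℝ) * (3 / ((n : ℝ) * ((n : ℝ) - 2) * ((n : ℝ) - 4))) =
        ((3 * (n - 3) * (n - 5).factorial : ℕ) : ℝ)) ∧
    (Odd n →
      IsGreatest
        {t : ℝ | ∃ V : FDRep ℂ (Perm (Fin n)), CategoryTheory.Simple V ∧
          V.character 1 ≠ 1 ∧ V.character h / V.character 1 = (t : ℂ)}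
        (2 / ((n : ℝ) * ((n : ℝ) - 3))) ∧
      ((n * (n - 2).factorial : ℕ) : ℝ) * (2 / ((n : ℝ) * ((n : ℝ) - 3))) =
        ((2 * (n - 2) * (n - 4).factorial : ℕ) : ℝ)) := by
  obtain ⟨m, rfl⟩ := Nat.exists_eq_add_of_le' (by omega : 2 ≤ n)
  have hm : 3 ≤ m := by omega
  have hm' : (3 : ℝ) ≤ m := by exact_mod_cast hm
  have hs : h.support.card = m + 1 := by omega
  have hfac : ((m + 2 - 2).factorial : ℝ) = m * ((m : ℝ) - 1) * ((m : ℝ) - 2) *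
      (m + 2 - 5).factorial ∧ ((m + 2 - 4).factorial : ℝ) = ((m : ℝ) - 2) * (m + 2 - 5).factorial ∧
      ((m + 2 - 3 : ℕ) : ℝ) = m - 1 := by
    obtain ⟨j, rfl⟩ := Nat.exists_eq_add_of_le' hm
    simp only [Nat.add_sub_cancel, Nat.add_assoc, Nat.reduceAdd, Nat.reduceSubDiff,
      Nat.factorial_succ]
    push_cast
    refine ⟨?_, ?_, ?_⟩ <;> ring
  obtain ⟨hf2, hf4, h3⟩ := hfac
  have hm0 : (m : ℝ) ≠ 0 := by linarith
  have hm1 : (m : ℝ) - 1 ≠ 0 := by linarith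
  have hm2 : (m : ℝ) - 2 ≠ 0 := by linarith
  refine ⟨fun he => ⟨?_, ?_⟩, fun ho => ⟨?_, ?_⟩⟩
  · have hme : Even m := by simpa [Nat.even_add] using he
    have hm4 : (4 : ℝ) ≤ m := by
      obtain ⟨r, hr⟩ := hme
      exact_mod_cast (by omega : 4 ≤ m)
    have hD := nearHookChar_two_one (m := m) (by omega)
    have hc : ((m + 2 : ℕ) : ℝ) * (((m + 2 : ℕ) : ℝ) - 2) * (((m + 2 : ℕ) : ℝ) - 4) =
        (m + 2) * m * (m - 2) := by
      push_cast
      ring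
    have hpos : (0 : ℝ) < (m + 2) * m * (m - 2) :=
      mul_pos (by positivity) (by linarith)
    rw [hc]
    refine isGreatest_character_div hcyc hs (fun k hk0 hk hke => ?_) two_pos (by omega)
      even_two ?_ ?_
    · rw [div_mul_eq_mul_div, one_le_div hpos]
      have := le_nearHookChar_one (m := m) (k := k)
        (by obtain ⟨r, hr⟩ := hke; omega)
        (by obtain ⟨r, hr⟩ := hke; obtain ⟨s, hs⟩ := hme; omega)
      linarith
    · rw [hD]
      field_simp
    · rw [hD]
      have : (6 : ℝ) * 4 * 2 ≤ (m + 2) * m * (m - 2) := by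
        gcongr <;> linarith
      intro h'
      linarith
  · rw [Nat.cast_mul, Nat.cast_mul, Nat.cast_mul, hf2, h3]
    push_cast
    rw [show (m : ℝ) + 2 - 2 = m by ring, show (m : ℝ) + 2 - 4 = m - 2 by ring]
    field_simp
  · have hmo : Odd m := by simpa [Nat.odd_add] using ho
    have hD := nearHookChar_last_one (m := m) (by omega)
    have hc : ((m + 2 : ℕ) : ℝ) * (((m + 2 : ℕ) : ℝ) - 3) = (m + 2) * (m - 1) := by
      push_cast
      ring
    have hpos : (0 : ℝ) < (m + 2) * (m - 1) := mul_pos (by positivity) (by linarith)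
    rw [hc]
    refine isGreatest_character_div (k₀ := m - 1) hcyc hs (fun k hk0 hk hke => ?_) (by omega)
      (by omega) (Nat.Odd.sub_odd hmo odd_one) ?_ ?_
    · rw [div_mul_eq_mul_div, one_le_div hpos]
      rcases eq_or_ne k (m - 1) with rfl | hne
      · rw [hD]
        linarith
      · have := le_nearHookChar_one (m := m) (k := k)
          (by obtain ⟨r, hr⟩ := hke; omega) (by omega)
        have h1 : (m + 2) * (3 * (m - 1)) ≤ ((m + 2) * (2 * m * (m - 2)) : ℝ) := by
          refine mul_le_mul_of_nonneg_left ?_ (by positivity)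
          nlinarith
        linarith
    · rw [hD]
      field_simp
    · rw [hD]
      have : (5 : ℝ) * 2 ≤ (m + 2) * (m - 1) := by
        gcongr <;> linarith
      intro h'
      linarith
  · rw [Nat.cast_mul, Nat.cast_mul, Nat.cast_mul, hf2, hf4]
    push_cast
    rw [show (m : ℝ) + 2 - 3 = m - 1 by ring]
    field_simp
end

section
/- Let n ≥ 2 and 1 ≤ r < k ≤ n, and let X be the smallest subgroup of S_n containing C(n,k;r). Then X = S_n if k is even, and X = A_n if k is odd. -/
open Equiv

/-- `C(n,k;r)`: the set of `k`-cycles in `S_n` moving every point of `{1,…,r}`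
(identified with the first `r` elements of `Fin n`). -/
def movingCycles (n k r : ℕ) : Set (Perm (Fin n)) :=
  {g : Perm (Fin n) | g.IsCycle ∧ g.support.card = k ∧
    ∀ i : Fin n, (i : ℕ) < r → i ∈ g.support}

theorem formPerm_mem_movingCycles {n k r : ℕ} (hk : 2 ≤ k) {l : List (Fin n)} (hl : l.Nodup)
    (hlen : l.length = k) (hmem : ∀ i : Fin n, (i : ℕ) < r → i ∈ l) :
    l.formPerm ∈ movingCycles n k r := by
  have hsupp : l.formPerm.support = l.toFinset :=
    List.support_formPerm_of_nodup l hl fun x hx => by simp [hx] at hlen; omega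
  refine ⟨List.isCycle_formPerm hl (hlen ▸ hk), ?_, fun i hi => ?_⟩
  · rw [hsupp, List.toFinset_card_of_nodup hl, hlen]
  · simpa [hsupp] using hmem i hi

theorem exists_superset_card_eq_of_forall_lt_mem {n k r : ℕ} (hkn : k ≤ n) {s : Finset (Fin n)}
    (hs : (s ∪ Finset.univ.filter fun i : Fin n => (i : ℕ) < r).card ≤ k) :
    ∃ t : Finset (Fin n), s ⊆ t ∧ t.card = k ∧ ∀ i : Fin n, (i : ℕ) < r → i ∈ t := by
  obtain ⟨t, hst, -, ht⟩ := Finset.exists_subsuperset_card_eq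
    (Finset.subset_univ (s ∪ Finset.univ.filter fun i : Fin n => (i : ℕ) < r)) hs (by simpa)
  exact ⟨t, Finset.subset_union_left.trans hst, ht,
    fun i hi => hst (Finset.mem_union_right _ (by simpa using hi))⟩

theorem card_filter_fin_val_lt_le (n r : ℕ) :
    (Finset.univ.filter fun i : Fin n => (i : ℕ) < r).card ≤ r := by
  simp [Fin.card_filter_val_lt]

theorem movingCycles_nonempty {n k r : ℕ} (hk : 2 ≤ k) (hrk : r ≤ k) (hkn : k ≤ n) :
    (movingCycles n k r).Nonempty := by
  obtain ⟨t, -, ht, hmem⟩ := exists_superset_card_eq_of_forall_lt_mem (s := ∅) hkn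
    (by simpa using (card_filter_fin_val_lt_le n r).trans hrk)
  exact ⟨_, formPerm_mem_movingCycles hk t.nodup_toList (by simpa using ht) (by simpa using hmem)⟩

theorem closure_range_swap_eq_top {α : Type*} [DecidableEq α] [Finite α] (z : α) :
    Subgroup.closure {σ : Perm α | ∃ c, c ≠ z ∧ σ = swap z c} = ⊤ := by
  have key (c : α) : swap z c ∈ Subgroup.closure {σ : Perm α | ∃ c, c ≠ z ∧ σ = swap z c} := by
    by_cases hc : c = z
    · simp [hc, ← Perm.one_def, one_mem]
    · exact Subgroup.subset_closure ⟨c, hc, rfl⟩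
  rw [eq_top_iff, ← Perm.closure_isSwap, Subgroup.closure_le]
  rintro _ ⟨x, y, hxy, rfl⟩
  by_cases hx : x = z
  · exact hx ▸ key y
  by_cases hy : y = z
  · rw [swap_comm, hy]
    exact key x
  have h : swap x y = swap z x * swap z y * swap z x := by
    rw [← swap_mul_swap_mul_swap hy hxy.symm, swap_comm y z]
  rw [h]
  exact mul_mem (mul_mem (key x) (key y)) (key x)

/-- A subgroup containing all products `(z a)(z c)`, for fixed `z` and `a`, contains all even
permutations. -/
theorem alternatingGroup_le_of_swap_mul_swap_mem {α : Type*} [DecidableEq α] [Fintype α] {z a : α}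
    {K : Subgroup (Perm α)}
    (hK : ∀ c, c ≠ z → c ≠ a → swap z a * swap z c ∈ K) : alternatingGroup α ≤ K := by
  have hK' (c : α) (hc : c ≠ z) : swap z a * swap z c ∈ K := by
    by_cases hca : c = a
    · simp [hca, one_mem]
    · exact hK c hc hca
  have key (σ : Perm α) :
      (Perm.sign σ = 1 → σ ∈ K) ∧ (Perm.sign σ = -1 → swap z a * σ ∈ K) := by
    have hσ : σ ∈ Subgroup.closure {σ : Perm α | ∃ c, c ≠ z ∧ σ = swap z c} :=
      closure_range_swap_eq_top z ▸ Subgroup.mem_top σ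
    have step (c : α) (hc : c ≠ z) (τ : Perm α)
        (ih : (Perm.sign τ = 1 → τ ∈ K) ∧ (Perm.sign τ = -1 → swap z a * τ ∈ K)) :
        (Perm.sign (swap z c * τ) = 1 → swap z c * τ ∈ K) ∧
          (Perm.sign (swap z c * τ) = -1 → swap z a * (swap z c * τ) ∈ K) := by
      rw [Perm.sign_mul, Perm.sign_swap hc.symm]
      refine ⟨fun h => ?_, fun h => ?_⟩
      · have h1 := mul_mem (inv_mem (hK' c hc)) (ih.2 (by simpa [neg_eq_iff_eq_neg] using h))
        simpa [mul_assoc] using h1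
      · rw [← mul_assoc]
        exact mul_mem (hK' c hc) (ih.1 (by simpa using h))
    induction hσ using Subgroup.closure_induction_left with
    | one => exact ⟨fun _ => one_mem K, fun h => absurd h (by simp)⟩
    | mul_left x hx y hy ih =>
      obtain ⟨c, hc, rfl⟩ := hx
      exact step c hc y ih
    | inv_mul_cancel x hx y hy ih =>
      obtain ⟨c, hc, rfl⟩ := hx
      rw [swap_inv]
      exact step c hc y ih
  exact fun σ hσ => (key σ).1 (Perm.mem_alternatingGroup.1 hσ)

theorem swap_mul_swap_mem_closure_movingCycles {n k r : ℕ} (hr : 1 ≤ r) (hrk : r < k)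
    (hkn : k ≤ n) {z a c : Fin n} (hz : (z : ℕ) = 0) (ha : (a : ℕ) = 1) (hcz : c ≠ z)
    (hca : c ≠ a) : swap z a * swap z c ∈ Subgroup.closure (movingCycles n k r) := by
  have hza : z ≠ a := fun h => by simp [h, ha] at hz
  obtain rfl | hk : k = 2 ∨ 3 ≤ k := by omega
  · have hswap (x : Fin n) (hx : x ≠ z) : swap z x ∈ Subgroup.closure (movingCycles n 2 r) := by
      have := formPerm_mem_movingCycles (r := r) le_rfl (l := [z, x]) (by simpa using hx.symm) rfl
        fun i hi => by
          have : i = z := Fin.ext (by omega)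
          simp [this]
      simpa using Subgroup.subset_closure this
    exact mul_mem (hswap a hza.symm) (hswap c hcz)
  have hcard : (({z, a, c} : Finset (Fin n)) ∪
      Finset.univ.filter fun i : Fin n => (i : ℕ) < r).card ≤ k := by
    by_cases hr1 : r = 1
    · refine le_trans (Finset.card_le_card (t := {z, a, c}) ?_) (Finset.card_le_three.trans hk)
      refine Finset.union_subset subset_rfl fun i hi => ?_
      have : i = z := Fin.ext (by simp at hi; omega)
      simp [this]
    · refine le_trans (Finset.card_le_card
        (t := insert c (Finset.univ.filter fun i : Fin n => (i : ℕ) < r)) ?_)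
        ((Finset.card_insert_le _ _).trans
          ((Nat.succ_le_succ (card_filter_fin_val_lt_le n r)).trans hrk))
      intro i hi
      simp only [Finset.mem_union, Finset.mem_insert, Finset.mem_singleton, Finset.mem_filter,
        Finset.mem_univ, true_and] at hi ⊢
      rcases hi with (rfl | rfl | rfl) | hi
      · right; omega
      · right; omega
      · left; rfl
      · right; exact hi
  obtain ⟨t, hst, ht, hmem⟩ := exists_superset_card_eq_of_forall_lt_mem hkn hcard
  set l := (t \ {z, a, c}).toList with hl
  have hlen : l.length + 3 = k := by
    have h3 : ({z, a, c} : Finset (Fin n)).card = 3 :=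
      Finset.card_eq_three.2 ⟨z, a, c, hza, hcz.symm, hca.symm, rfl⟩
    rw [hl, Finset.length_toList, ← h3, Finset.card_sdiff_add_card_eq_card hst, ht]
  have hnodup : l.Nodup := Finset.nodup_toList _
  have hml (i : Fin n) : i ∈ l ↔ i ∈ t ∧ i ≠ z ∧ i ≠ a ∧ i ≠ c := by simp [hl]
  have h₁ : (z :: a :: c :: l).formPerm ∈ movingCycles n k r := by
    refine formPerm_mem_movingCycles (by omega) ?_ (by simpa using hlen) fun i hi => ?_
    · simp [hml, hnodup, hza, hcz.symm, hca.symm]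
    · have := hmem i hi
      simp only [List.mem_cons, hml]
      tauto
  have h₂ : (a :: z :: c :: l).formPerm ∈ movingCycles n k r := by
    refine formPerm_mem_movingCycles (by omega) ?_ (by simpa using hlen) fun i hi => ?_
    · simp [hml, hnodup, hza.symm, hcz.symm, hca.symm]
    · have := hmem i hi
      simp only [List.mem_cons, hml]
      tauto
  have h := mul_mem (Subgroup.subset_closure h₁) (inv_mem (Subgroup.subset_closure h₂))
  convert h using 1
  simp only [List.formPerm_cons_cons, mul_inv_rev, swap_inv]
  rw [swap_comm a c, ← swap_mul_swap_mul_swap hza.symm hca.symm, swap_comm a z]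
  simp [mul_assoc]

/-- Let `n ≥ 2`, `1 ≤ r < k ≤ n` and let `X` be the smallest subgroup of `S_n` containing
`C(n,k;r)`.  Then `X = S_n` if `k` is even and `X = A_n` if `k` is odd. -/
theorem stmt14 (n k r : ℕ) (hn : 2 ≤ n) (hr : 1 ≤ r) (hrk : r < k) (hkn : k ≤ n) :
    (Even k → Subgroup.closure (movingCycles n k r) = ⊤) ∧
    (Odd k → Subgroup.closure (movingCycles n k r) = alternatingGroup (Fin n)) := by
  have hle : alternatingGroup (Fin n) ≤ Subgroup.closure (movingCycles n k r) :=
    alternatingGroup_le_of_swap_mul_swap_mem (z := ⟨0, by omega⟩) (a := ⟨1, by omega⟩)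
      fun c hcz hca => swap_mul_swap_mem_closure_movingCycles hr hrk hkn rfl rfl hcz hca
  have hsign (g) (hg : g ∈ movingCycles n k r) : Perm.sign g = -(-1) ^ k := by
    rw [hg.1.sign, hg.2.1]
  refine ⟨fun hk => ?_, fun hk => le_antisymm ?_ hle⟩
  · obtain ⟨g, hg⟩ := movingCycles_nonempty (n := n) (k := k) (r := r) (by omega) hrk.le hkn
    have hg' := hsign g hg
    rw [hk.neg_one_pow] at hg'
    refine eq_top_iff.2 fun σ _ => ?_
    rcases Int.units_eq_one_or (Perm.sign σ) with hσ | hσ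
    · exact hle (Perm.mem_alternatingGroup.2 hσ)
    · have h : g * σ ∈ Subgroup.closure (movingCycles n k r) :=
        hle (Perm.mem_alternatingGroup.2 (by rw [Perm.sign_mul, hσ, hg']; simp))
      exact (Subgroup.mul_mem_cancel_left _ (Subgroup.subset_closure hg)).1 h
  · refine (Subgroup.closure_le _).2 fun g hg => Perm.mem_alternatingGroup.2 ?_
    rw [hsign g hg, hk.neg_one_pow, neg_neg]
end
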